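/- Let H be an N-body Hamiltonian H = −½Δ + Σ_{1≤i<j≤N} w(r_i−r_j) + Σ_{i=1}^N v(r_i) on the antisymmetric space H_N = ⋀_{i=1}^N L²(ℝ³), with v, w ∈ L²(ℝ³)+L^∞(ℝ³) real-valued, such that the ground-state energy E₀ of H is a simple isolated eigenvalue and the ground-state density ρ^{Ψ₀} is bounded. Let χ₀ be the density-density response function of H, let χ^RPA be the unique strongly continuous solution of the RPA Dyson equation χ^RPA(t) = χ₀(t) + ∫₀ᵗ χ₀(t−s) F_H χ^RPA(s) ds, let Ω = inf σ_ess(H) − E₀ and D_Ω = ℂ \ ((−∞,−Ω] ∪ [Ω,∞)). Then the Fourier transform z ↦ ∫₀^∞ χ^RPA(t) e^{izt} dt, initially defined for Im z large, extends uniquely to a meromorphic family of operators from D_Ω to B(L²(ℝ³)+L^∞(ℝ³), L¹(ℝ³)∩L²(ℝ³)) whose poles are simple and contained in the real interval (−Ω, Ω). -/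

import Mathlib

/-!
STATEMENT 2: The Fourier transform of the RPA density-density response function extends
to a meromorphic family of operators on `D_Ω` with simple poles contained in `(−Ω, Ω)`.
-/

open MeasureTheory ENNReal NNReal Complex
noncomputable section

/-- Euclidean space `ℝ³`. -/
abbrev R3 : Type := EuclideanSpace ℝ (Fin 3)

/-- The Lebesgue space `L^p(ℝ³; ℂ)`. -/
abbrev Lsp (p : ℝ≥0∞) : Type := Lp ℂ p (volume : Measure R3)

/-- The Banach space `L¹(ℝ³) ∩ L²(ℝ³)` (with the max norm), realized as the submodule of
`L¹ × L²` of pairs whose two components agree almost everywhere. -/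
def interSub : Submodule ℂ (Lsp 1 × Lsp 2) where
  carrier := {f | (f.1 : R3 → ℂ) =ᵐ[volume] (f.2 : R3 → ℂ)}
  add_mem' := by
    intro a b ha hb
    simp only [Set.mem_setOf_eq] at *
    have h1 := Lp.coeFn_add a.1 b.1
    have h2 := Lp.coeFn_add a.2 b.2
    filter_upwards [h1, h2, ha, hb] with x e1 e2 e3 e4
    show ((a.1 + b.1 : Lsp 1) : R3 → ℂ) x = ((a.2 + b.2 : Lsp 2) : R3 → ℂ) x
    rw [e1, e2]
    simp [e3, e4]
  zero_mem' := by
    simp only [Set.mem_setOf_eq]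
    have h1 := Lp.coeFn_zero ℂ 1 (volume : Measure R3)
    have h2 := Lp.coeFn_zero ℂ 2 (volume : Measure R3)
    filter_upwards [h1, h2] with x e1 e2
    show ((0 : Lsp 1) : R3 → ℂ) x = ((0 : Lsp 2) : R3 → ℂ) x
    rw [e1, e2]
  smul_mem' := by
    intro c a ha
    simp only [Set.mem_setOf_eq] at *
    have h1 := Lp.coeFn_smul c a.1
    have h2 := Lp.coeFn_smul c a.2
    filter_upwards [h1, h2, ha] with x e1 e2 e3
    show ((c • a.1 : Lsp 1) : R3 → ℂ) x = ((c • a.2 : Lsp 2) : R3 → ℂ) x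
    rw [e1, e2]
    simp [e3]

/-- The Banach space `L¹(ℝ³) ∩ L²(ℝ³)`. -/
abbrev L1capL2 : Type := ↥interSub

/-- The subspace of `L² × L^∞` of pairs summing to `0` a.e. (the "diagonal"). -/
def diagSub₀ : Submodule ℂ (Lsp 2 × Lsp ∞) where
  carrier := {f | (fun x => (f.1 : R3 → ℂ) x + (f.2 : R3 → ℂ) x) =ᵐ[volume] 0}
  add_mem' := by
    intro a b ha hb
    simp only [Set.mem_setOf_eq] at *
    have h1 := Lp.coeFn_add a.1 b.1
    have h2 := Lp.coeFn_add a.2 b.2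
    filter_upwards [h1, h2, ha, hb] with x e1 e2 e3 e4
    show ((a.1 + b.1 : Lsp 2) : R3 → ℂ) x + ((a.2 + b.2 : Lsp ∞) : R3 → ℂ) x = 0
    rw [e1, e2]
    have e3' : (a.1 : R3 → ℂ) x + (a.2 : R3 → ℂ) x = 0 := e3
    have e4' : (b.1 : R3 → ℂ) x + (b.2 : R3 → ℂ) x = 0 := e4
    simp only [Pi.add_apply]
    linear_combination e3' + e4'
  zero_mem' := by
    simp only [Set.mem_setOf_eq]
    have h1 := Lp.coeFn_zero ℂ 2 (volume : Measure R3)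
    have h2 := Lp.coeFn_zero ℂ ∞ (volume : Measure R3)
    filter_upwards [h1, h2] with x e1 e2
    show ((0 : Lsp 2) : R3 → ℂ) x + ((0 : Lsp ∞) : R3 → ℂ) x = 0
    rw [e1, e2]; simp
  smul_mem' := by
    intro c a ha
    simp only [Set.mem_setOf_eq] at *
    have h1 := Lp.coeFn_smul c a.1
    have h2 := Lp.coeFn_smul c a.2
    filter_upwards [h1, h2, ha] with x e1 e2 e3
    show ((c • a.1 : Lsp 2) : R3 → ℂ) x + ((c • a.2 : Lsp ∞) : R3 → ℂ) x = 0
    rw [e1, e2]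
    have e3' : (a.1 : R3 → ℂ) x + (a.2 : R3 → ℂ) x = 0 := e3
    simp only [Pi.smul_apply, smul_eq_mul]
    linear_combination c * e3'

/-- The closure of the diagonal (equal to it, since the diagonal is closed). -/
abbrev diagSub : Submodule ℂ (Lsp 2 × Lsp ∞) := diagSub₀.topologicalClosure

instance : IsClosed (diagSub : Set (Lsp 2 × Lsp ∞)) := diagSub₀.isClosed_topologicalClosure

/-- The Banach space `L²(ℝ³) + L^∞(ℝ³)` (with the quotient norm), realized as the quotient of
`L² × L^∞` by the diagonal. -/
abbrev L2plusLinf : Type := (Lsp 2 × Lsp ∞) ⧸ diagSub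

/-- The (isometric) inclusion `L¹ ∩ L² ↪ L¹ × L²`. -/
abbrev inclι : L1capL2 →L[ℂ] (Lsp 1 × Lsp 2) := interSub.subtypeL

/-- `F_H` is the Hartree operator, i.e. convolution against `1/|·|` on `ℝ³`; it is bounded
from `L¹ ∩ L²` to `L² + L^∞` by the Hardy–Littlewood–Sobolev inequality. -/
def IsHartree (FH : L1capL2 →L[ℂ] L2plusLinf) : Prop :=
  ∀ f : L1capL2, ∃ g : Lsp 2 × Lsp ∞,
    (Submodule.Quotient.mk g : L2plusLinf) = FH f ∧
    (fun x => (g.1 : R3 → ℂ) x + (g.2 : R3 → ℂ) x) =ᵐ[volume]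
      (fun x => ∫ y : R3, ((‖x - y‖ : ℂ))⁻¹ * ((f.1.1 : R3 → ℂ) y))

/-- Strong continuity of an operator-valued map on `ℝ₊`. -/
def SCont {E F : Type*} [SeminormedAddCommGroup E] [NormedSpace ℂ E]
    [SeminormedAddCommGroup F] [NormedSpace ℂ F] (χ : ℝ≥0 → (E →L[ℂ] F)) : Prop :=
  ∀ f : E, Continuous fun t => χ t f

/-- The RPA Dyson equation `χ(t) = χ₀(t) + ∫₀ᵗ χ₀(t−s) F_H χ(s) ds` for all `t ≥ 0`
(the integral being a Bochner integral, stated strongly). -/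
def SolvesDyson (FH : L1capL2 →L[ℂ] L2plusLinf)
    (χ₀ χ : ℝ≥0 → (L2plusLinf →L[ℂ] L1capL2)) : Prop :=
  ∀ (t : ℝ≥0) (f : L2plusLinf),
    IntervalIntegrable
      (fun s : ℝ => inclι (χ₀ (t - Real.toNNReal s) (FH (χ (Real.toNNReal s) f))))
      volume 0 (t : ℝ) ∧
    inclι (χ t f) = inclι (χ₀ t f) +
      ∫ s in (0:ℝ)..(t:ℝ), inclι (χ₀ (t - Real.toNNReal s) (FH (χ (Real.toNNReal s) f)))

/-! ### Meromorphic families of operators (Definition 2.7) -/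

section Merom

variable {E F : Type*} [NormedAddCommGroup E] [NormedSpace ℂ E]
  [NormedAddCommGroup F] [NormedSpace ℂ F]

/-- A finite-rank (bounded) operator. -/
def FiniteRankOp (A : E →L[ℂ] F) : Prop := FiniteDimensional ℂ ↥(LinearMap.range (A : E →ₗ[ℂ] F))

/-- `K` is a meromorphic family of operators near `z₀`: near `z₀` it equals a holomorphic
family plus finitely many finite-rank principal parts `K₋ⱼ/(z−z₀)ʲ`. -/
def MeromAt (K : ℂ → (E →L[ℂ] F)) (z₀ : ℂ) : Prop :=
  ∃ (k : ℕ) (c : ℕ → (E →L[ℂ] F)) (K₀ : ℂ → (E →L[ℂ] F)) (U : Set ℂ),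
    IsOpen U ∧ z₀ ∈ U ∧ AnalyticOnNhd ℂ K₀ U ∧ (∀ j, FiniteRankOp (c j)) ∧
    ∀ z ∈ U, z ≠ z₀ → K z = K₀ z + ∑ j ∈ Finset.range k, ((z - z₀) ^ (j + 1))⁻¹ • c j

/-- `K` is a meromorphic family of operators on the open set `D`. -/
def MeromOn (K : ℂ → (E →L[ℂ] F)) (D : Set ℂ) : Prop := ∀ z₀ ∈ D, MeromAt K z₀

/-- `K` has a simple pole at `z₀` with (finite-rank, nonzero) residue `R`. -/
def SimplePoleAt (K : ℂ → (E →L[ℂ] F)) (z₀ : ℂ) (R : E →L[ℂ] F) : Prop :=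
  R ≠ 0 ∧ FiniteRankOp R ∧
  ∃ (K₀ : ℂ → (E →L[ℂ] F)) (U : Set ℂ), IsOpen U ∧ z₀ ∈ U ∧ AnalyticOnNhd ℂ K₀ U ∧
    ∀ z ∈ U, z ≠ z₀ → K z = K₀ z + (z - z₀)⁻¹ • R

/-- `K` has a (simple) pole at `z₀`. -/
def IsPoleAt (K : ℂ → (E →L[ℂ] F)) (z₀ : ℂ) : Prop := ∃ R, SimplePoleAt K z₀ R

open scoped Classical in
/-- The rank of a (simple) pole of `K` at `z₀`: the rank of the residue there
(`0` if there is no simple pole at `z₀`). -/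
noncomputable def poleRank (K : ℂ → (E →L[ℂ] F)) (z₀ : ℂ) : ℕ :=
  if h : ∃ R, SimplePoleAt K z₀ R then Module.finrank ℂ ↥(LinearMap.range (h.choose : E →ₗ[ℂ] F)) else 0

end Merom

/-- The domain `D_Ω = ℂ \ ((−∞,−Ω] ∪ [Ω,∞))`. -/
def DOmega (Ω : ℝ) : Set ℂ := {z : ℂ | z.im ≠ 0 ∨ |z.re| < Ω}
/-! ### Self-adjoint Hamiltonians, encoded through their projection-valued spectral measure -/

open scoped InnerProductSpace

/-- The spectral data of a self-adjoint Hamiltonian `H`: the projection-valued spectral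
measure `A ↦ P^H(A)` together with the diagonal spectral measures
`x ↦ μ_x = ⟪x, P^H(·) x⟫ = ‖P^H(·)x‖²`. -/
structure SpectralData (𝓗 : Type*) [NormedAddCommGroup 𝓗] [InnerProductSpace ℂ 𝓗] where
  proj : Set ℝ → (𝓗 →L[ℂ] 𝓗)
  diag : 𝓗 → MeasureTheory.Measure ℝ
  proj_symm : ∀ A : Set ℝ, MeasurableSet A → ∀ x y : 𝓗, ⟪proj A x, y⟫_ℂ = ⟪x, proj A y⟫_ℂ
  proj_comp : ∀ A B : Set ℝ, MeasurableSet A → MeasurableSet B →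
    proj A ∘L proj B = proj (A ∩ B)
  proj_univ : proj Set.univ = ContinuousLinearMap.id ℂ 𝓗
  diag_apply : ∀ (x : 𝓗) (A : Set ℝ), MeasurableSet A →
    diag x A = (‖proj A x‖₊ : ℝ≥0∞) ^ 2

variable {𝓗 : Type*} [NormedAddCommGroup 𝓗] [InnerProductSpace ℂ 𝓗]

/-- The spectrum `σ(H)` (the support of the spectral measure). -/
def SpectralData.spec (P : SpectralData 𝓗) : Set ℝ :=
  {a | ∀ ε > 0, P.proj (Set.Ioo (a - ε) (a + ε)) ≠ 0}

/-- The essential spectrum `σ_ess(H)` (the points at which every spectral window has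
infinite rank). -/
def SpectralData.essSpec (P : SpectralData 𝓗) : Set ℝ :=
  {a | ∀ ε > 0, ¬ FiniteDimensional ℂ ↥(LinearMap.range (P.proj (Set.Ioo (a - ε) (a + ε)) : 𝓗 →ₗ[ℂ] 𝓗))}

/-- Assumption 1: `E₀` is the ground-state energy of `H`, a simple isolated eigenvalue with
normalized ground state `Ψ₀`. -/
structure IsGroundState (P : SpectralData 𝓗) (E₀ : ℝ) (Ψ₀ : 𝓗) : Prop where
  unit : ‖Ψ₀‖ = 1
  bottom : P.proj (Set.Iio E₀) = 0
  eig : P.proj {E₀} Ψ₀ = Ψ₀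
  simple : LinearMap.range (P.proj {E₀} : 𝓗 →ₗ[ℂ] 𝓗) = Submodule.span ℂ {Ψ₀}
  isolated : ∃ ε > 0, P.proj (Set.Ioo (E₀ - ε) (E₀ + ε)) = P.proj {E₀}
/-- `K` is the Fourier transform `z ↦ ∫₀^∞ χ(t) e^{izt} dt` of the operator-valued function
`χ`, for `Im z > D` (stated strongly, through the isometric inclusion
`ι : L¹∩L² → L¹ × L²`). -/
def IsFourierTransformOf (χ : ℝ≥0 → (L2plusLinf →L[ℂ] L1capL2))
    (K : ℂ → (L2plusLinf →L[ℂ] L1capL2)) (D : ℝ) : Prop :=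
  ∀ z : ℂ, D < z.im → ∀ f : L2plusLinf,
    MeasureTheory.IntegrableOn
      (fun t : ℝ => Complex.exp (Complex.I * z * t) • inclι (χ (Real.toNNReal t) f))
      (Set.Ioi 0) volume ∧
    inclι (K z f) =
      ∫ t in Set.Ioi (0:ℝ), Complex.exp (Complex.I * z * t) • inclι (χ (Real.toNNReal t) f)

/-! ### Bounded Borel functional calculus of a projection-valued measure -/

/-- Bounded Borel functions on the line. -/
def BddMeas (f : ℝ → ℂ) : Prop := Measurable f ∧ ∃ c : ℝ, ∀ a, ‖f a‖ ≤ c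

theorem BddMeas.indicator_const {A : Set ℝ} (hA : MeasurableSet A) (c : ℂ) :
    BddMeas (A.indicator fun _ => c) :=
  ⟨measurable_const.indicator hA, ‖c‖, fun a => norm_indicator_le_norm_self _ a⟩

theorem BddMeas.add {f g : ℝ → ℂ} (hf : BddMeas f) (hg : BddMeas g) : BddMeas (f + g) := by
  obtain ⟨hf, c, hc⟩ := hf
  obtain ⟨hg, d, hd⟩ := hg
  exact ⟨hf.add hg, c + d, fun a => (norm_add_le _ _).trans (add_le_add (hc a) (hd a))⟩

theorem BddMeas.mul {f g : ℝ → ℂ} (hf : BddMeas f) (hg : BddMeas g) : BddMeas (f * g) := by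
  obtain ⟨hf, c, hc⟩ := hf
  obtain ⟨hg, d, hd⟩ := hg
  refine ⟨hf.mul hg, c * d, fun a => ?_⟩
  rw [Pi.mul_apply, norm_mul]
  exact mul_le_mul (hc a) (hd a) (norm_nonneg _) ((norm_nonneg _).trans (hc a))

theorem BddMeas.neg {f : ℝ → ℂ} (hf : BddMeas f) : BddMeas (-f) := by
  obtain ⟨hf, c, hc⟩ := hf
  exact ⟨hf.neg, c, fun a => by simpa using hc a⟩

theorem BddMeas.sub {f g : ℝ → ℂ} (hf : BddMeas f) (hg : BddMeas g) : BddMeas (f - g) := by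
  rw [sub_eq_add_neg]; exact hf.add hg.neg

theorem BddMeas.conj {f : ℝ → ℂ} (hf : BddMeas f) :
    BddMeas (fun a => (starRingEnd ℂ) (f a)) := by
  obtain ⟨hf, c, hc⟩ := hf
  exact ⟨Complex.continuous_conj.measurable.comp hf, c, fun a => by simpa using hc a⟩

theorem SimpleFunc.bddMeas (s : SimpleFunc ℝ ℂ) : BddMeas s := by
  refine ⟨s.measurable, ?_⟩
  obtain ⟨c, hc⟩ := (s.finite_range.isBounded).exists_norm_le
  exact ⟨c, fun a => hc _ (Set.mem_range_self a)⟩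

/-- A bounded Borel function is a uniform limit of simple functions. -/
theorem BddMeas.exists_simpleFunc {f : ℝ → ℂ} (hf : BddMeas f) {ε : ℝ} (hε : 0 < ε) :
    ∃ s : SimpleFunc ℝ ℂ, ∀ a, ‖f a - s a‖ ≤ ε := by
  obtain ⟨hm, c, hc⟩ := hf
  have key : ∀ u : ℝ → ℝ, Measurable u → (∀ a, |u a| ≤ c) →
      ∃ s : SimpleFunc ℝ ℝ, ∀ a, |u a - s a| ≤ ε / 2 := by
    intro u hu hb
    refine ⟨⟨fun a => (⌊u a / (ε / 2)⌋ : ℝ) * (ε / 2), ?_, ?_⟩, ?_⟩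
    · intro x
      have : Measurable fun a => (⌊u a / (ε / 2)⌋ : ℝ) * (ε / 2) := by fun_prop
      exact this (measurableSet_singleton x)
    · refine ((Set.finite_Icc ⌊-c / (ε / 2)⌋ ⌊c / (ε / 2)⌋).image
        (fun n : ℤ => (n : ℝ) * (ε / 2))).subset ?_
      rintro _ ⟨a, rfl⟩
      refine ⟨⌊u a / (ε / 2)⌋, ⟨?_, ?_⟩, rfl⟩
      · have := (abs_le.1 (hb a)).1
        apply Int.floor_le_floor; gcongr
      · have := (abs_le.1 (hb a)).2
        apply Int.floor_le_floor; gcongr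
    · intro a
      have h2 : 0 < ε / 2 := by positivity
      have h1 := Int.floor_le (u a / (ε / 2))
      have h3 := Int.lt_floor_add_one (u a / (ε / 2))
      rw [le_div_iff₀ h2] at h1
      rw [div_lt_iff₀ h2] at h3
      show |u a - (⌊u a / (ε / 2)⌋ : ℝ) * (ε / 2)| ≤ ε / 2
      rw [abs_le]; constructor <;> nlinarith
  obtain ⟨s, hs⟩ := key (fun a => (f a).re) (Complex.measurable_re.comp hm)
    fun a => (Complex.abs_re_le_norm _).trans (hc a)
  obtain ⟨t, ht⟩ := key (fun a => (f a).im) (Complex.measurable_im.comp hm)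
    fun a => (Complex.abs_im_le_norm _).trans (hc a)
  refine ⟨(s.pair t).map (fun p => (⟨p.1, p.2⟩ : ℂ)), fun a => ?_⟩
  refine (Complex.norm_le_abs_re_add_abs_im _).trans ?_
  have h1 := hs a
  have h2 := ht a
  simp only [SimpleFunc.map_apply, SimpleFunc.pair_apply, Complex.sub_re, Complex.sub_im]
  linarith

theorem BddMeas.induction {p : ∀ f : ℝ → ℂ, BddMeas f → Prop}
    (ind : ∀ (A : Set ℝ) (hA : MeasurableSet A) (c : ℂ),
      p (A.indicator fun _ => c) (BddMeas.indicator_const hA c))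
    (add : ∀ f g (hf : BddMeas f) (hg : BddMeas g), p f hf → p g hg → p (f + g) (hf.add hg))
    (lim : ∀ f (hf : BddMeas f),
      (∀ ε > 0, ∃ (g : ℝ → ℂ) (hg : BddMeas g), p g hg ∧ ∀ a, ‖f a - g a‖ ≤ ε) → p f hf)
    {f : ℝ → ℂ} (hf : BddMeas f) : p f hf := by
  have hsimple : ∀ s : SimpleFunc ℝ ℂ, p s (SimpleFunc.bddMeas s) := by
    intro s
    induction s using SimpleFunc.induction with
    | @const c A hA =>
      have e : ⇑(SimpleFunc.piecewise A hA (SimpleFunc.const ℝ c) (SimpleFunc.const ℝ 0)) =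
          A.indicator fun _ => c := by
        ext a
        by_cases h : a ∈ A <;> simp [h]
      have := ind A hA c
      simpa only [e] using this
    | add hd h1 h2 =>
      have := add _ _ (SimpleFunc.bddMeas _) (SimpleFunc.bddMeas _) h1 h2
      simpa only [SimpleFunc.coe_add] using this
  refine lim f hf fun ε hε => ?_
  obtain ⟨s, hs⟩ := hf.exists_simpleFunc hε
  exact ⟨s, SimpleFunc.bddMeas s, hsimple s, hs⟩

namespace SpectralData

variable (P : SpectralData 𝓗)

theorem diag_univ (x : 𝓗) : P.diag x Set.univ = (‖x‖₊ : ℝ≥0∞) ^ 2 := by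
  rw [P.diag_apply x _ MeasurableSet.univ, P.proj_univ]; rfl

instance isFiniteMeasure_diag (x : 𝓗) : IsFiniteMeasure (P.diag x) :=
  ⟨by rw [P.diag_univ]; exact ENNReal.pow_lt_top ENNReal.coe_lt_top⟩

theorem diag_real_univ (x : 𝓗) : (P.diag x).real Set.univ = ‖x‖ ^ 2 := by
  rw [measureReal_def, P.diag_univ]; simp

theorem diag_real (x : 𝓗) {A : Set ℝ} (hA : MeasurableSet A) :
    (P.diag x).real A = ‖P.proj A x‖ ^ 2 := by
  rw [measureReal_def, P.diag_apply x A hA]; simp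

theorem inner_proj (x : 𝓗) {A : Set ℝ} (hA : MeasurableSet A) :
    ⟪x, P.proj A x⟫_ℂ = (‖P.proj A x‖ : ℂ) ^ 2 := by
  have h := P.proj_comp A A hA hA
  rw [Set.inter_self] at h
  conv_lhs => rw [← h]
  rw [ContinuousLinearMap.comp_apply, ← P.proj_symm A hA, inner_self_eq_norm_sq_to_K]
  rfl

theorem integrable_of_bddMeas {f : ℝ → ℂ} (hf : BddMeas f) (x : 𝓗) :
    Integrable f (P.diag x) := by
  obtain ⟨hm, c, hc⟩ := hf
  exact Integrable.of_bound hm.aestronglyMeasurable c (Filter.Eventually.of_forall hc)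

/-- `T` is the operator `∫ f dP`. -/
def Represents (f : ℝ → ℂ) (T : 𝓗 →L[ℂ] 𝓗) : Prop :=
  ∀ x : 𝓗, ⟪x, T x⟫_ℂ = ∫ a, f a ∂P.diag x

variable {P}

namespace Represents

theorem unique {f : ℝ → ℂ} {T T' : 𝓗 →L[ℂ] 𝓗} (h : P.Represents f T)
    (h' : P.Represents f T') : T = T' := by
  apply ContinuousLinearMap.coe_injective
  rw [← ext_inner_map]
  intro x
  have := congrArg (starRingEnd ℂ) ((h x).trans (h' x).symm)
  simpa [inner_conj_symm] using this

theorem congr {f g : ℝ → ℂ} {T : 𝓗 →L[ℂ] 𝓗} (h : P.Represents f T) {A : Set ℝ}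
    (hA : MeasurableSet A) (hP : P.proj A = 0) (hfg : ∀ a ∉ A, f a = g a) :
    P.Represents g T := by
  intro x
  rw [h x]
  apply integral_congr_ae
  have : P.diag x A = 0 := by rw [P.diag_apply x A hA, hP]; simp
  rw [Filter.eventuallyEq_iff_exists_mem]
  exact ⟨Aᶜ, compl_mem_ae_iff.2 this, fun a ha => hfg a ha⟩

theorem add {f g : ℝ → ℂ} {T S : 𝓗 →L[ℂ] 𝓗} (hf : BddMeas f) (hg : BddMeas g)
    (h : P.Represents f T) (h' : P.Represents g S) : P.Represents (f + g) (T + S) := by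
  intro x
  rw [_root_.add_apply, inner_add_right, h x, h' x]
  exact (integral_add (P.integrable_of_bddMeas hf x) (P.integrable_of_bddMeas hg x)).symm

theorem smul {f : ℝ → ℂ} {T : 𝓗 →L[ℂ] 𝓗} (c : ℂ) (h : P.Represents f T) :
    P.Represents (fun a => c * f a) (c • T) := by
  intro x
  rw [_root_.smul_apply, inner_smul_right, h x, integral_const_mul]

theorem sub {f g : ℝ → ℂ} {T S : 𝓗 →L[ℂ] 𝓗} (hf : BddMeas f) (hg : BddMeas g)
    (h : P.Represents f T) (h' : P.Represents g S) : P.Represents (f - g) (T - S) := by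
  intro x
  rw [_root_.sub_apply, inner_sub_right, h x, h' x]
  exact (integral_sub (P.integrable_of_bddMeas hf x) (P.integrable_of_bddMeas hg x)).symm

theorem indicator (P : SpectralData 𝓗) {A : Set ℝ} (hA : MeasurableSet A) (c : ℂ) :
    P.Represents (A.indicator fun _ => c) (c • P.proj A) := by
  intro x
  rw [_root_.smul_apply, inner_smul_right, P.inner_proj x hA,
    integral_indicator_const _ hA, P.diag_real x hA]
  simp [mul_comm]

theorem norm_integral_le (P : SpectralData 𝓗) {f : ℝ → ℂ} {c : ℝ} (hc : ∀ a, ‖f a‖ ≤ c) (x : 𝓗) :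
    ‖∫ a, f a ∂P.diag x‖ ≤ c * ‖x‖ ^ 2 := by
  have := norm_integral_le_of_norm_le_const (μ := P.diag x) (Filter.Eventually.of_forall hc)
  rwa [P.diag_real_univ] at this

theorem norm_le_two_mul {f : ℝ → ℂ} {T : 𝓗 →L[ℂ] 𝓗} (h : P.Represents f T)
    {c : ℝ} (hc : ∀ a, ‖f a‖ ≤ c) : ‖T‖ ≤ 2 * c := by
  have hc0 : 0 ≤ c := (norm_nonneg _).trans (hc 0)
  have hq : ∀ x, ‖⟪T x, x⟫_ℂ‖ ≤ c * ‖x‖ ^ 2 := by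
    intro x
    rw [norm_inner_symm, h x]
    exact norm_integral_le P hc x
  have hpol : ∀ x y : 𝓗, ‖x‖ = 1 → ‖y‖ = 1 → ‖⟪T y, x⟫_ℂ‖ ≤ 2 * c := by
    intro x y hx hy
    have hp := inner_map_polarization (T : 𝓗 →ₗ[ℂ] 𝓗) x y
    simp only [ContinuousLinearMap.coe_coe] at hp
    have p1 := parallelogram_law_with_norm ℂ x y
    have p2 := parallelogram_law_with_norm ℂ x (Complex.I • y)
    rw [norm_smul, Complex.norm_I, one_mul] at p2
    have h1 := hq (x + y)
    have h2 := hq (x - y)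
    have h3 := hq (x + Complex.I • y)
    have h4 := hq (x - Complex.I • y)
    rw [hp, norm_div]
    rw [div_le_iff₀ (by norm_num)]
    refine (norm_sub_le _ _).trans ?_
    refine (add_le_add_left (norm_add_le _ _) _).trans ?_
    refine (add_le_add_left (add_le_add_left (norm_sub_le _ _) _) _).trans ?_
    simp only [norm_mul, Complex.norm_I, one_mul]
    rw [hx, hy] at p1 p2
    simp only [Complex.norm_ofNat]
    nlinarith
  refine ContinuousLinearMap.opNorm_le_bound _ (by positivity) fun y => ?_
  by_cases hy : y = 0
  · simp [hy]
  by_cases hT : T y = 0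
  · rw [hT]; simp; positivity
  have hy' : (‖y‖ : ℂ) ≠ 0 := by simpa using hy
  have hT' : (‖T y‖ : ℂ) ≠ 0 := by simpa using hT
  have := hpol ((‖T y‖ : ℂ)⁻¹ • T y) ((‖y‖ : ℂ)⁻¹ • y) (norm_smul_inv_norm hT) (norm_smul_inv_norm hy)
  rw [map_smul, inner_smul_left, inner_smul_right, inner_self_eq_norm_sq_to_K] at this
  simp only [norm_mul, norm_inv, Complex.norm_real, norm_norm, RCLike.norm_conj, norm_pow, Complex.coe_algebraMap] at this
  have e : ‖y‖⁻¹ * (‖T y‖⁻¹ * ‖T y‖ ^ 2) = ‖T y‖ / ‖y‖ := by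
    have : ‖T y‖ ≠ 0 := by simpa using hT
    field_simp
  rw [e, div_le_iff₀ (norm_pos_iff.2 hy)] at this
  exact this

theorem norm_sub_le {f g : ℝ → ℂ} {T S : 𝓗 →L[ℂ] 𝓗} (hf : BddMeas f) (hg : BddMeas g)
    (h : P.Represents f T) (h' : P.Represents g S) {c : ℝ} (hc : ∀ a, ‖f a - g a‖ ≤ c) :
    ‖T - S‖ ≤ 2 * c :=
  (h.sub hf hg h').norm_le_two_mul hc

theorem exists_of_bddMeas [CompleteSpace 𝓗] (P : SpectralData 𝓗) {f : ℝ → ℂ} (hf : BddMeas f) :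
    ∃ T, P.Represents f T := by
  induction hf using BddMeas.induction with
  | ind A hA c => exact ⟨_, indicator P hA c⟩
  | add f g hf hg h1 h2 =>
    obtain ⟨T, hT⟩ := h1
    obtain ⟨S, hS⟩ := h2
    exact ⟨_, hT.add hf hg hS⟩
  | lim f hf h =>
    have hpos : ∀ n : ℕ, (0 : ℝ) < 1 / (n + 1) := fun n => by positivity
    choose g hg hT hfg using fun n : ℕ => h _ (hpos n)
    choose T hT using hT
    have hgg : ∀ N n m : ℕ, N ≤ n → N ≤ m → ∀ a, ‖g n a - g m a‖ ≤ 2 * (1 / (N + 1)) := by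
      intro N n m hn hm a
      have h1 := hfg n a
      have h2 := hfg m a
      have e1 : (1 : ℝ) / (n + 1) ≤ 1 / (N + 1) := by gcongr
      have e2 : (1 : ℝ) / (m + 1) ≤ 1 / (N + 1) := by gcongr
      have : g n a - g m a = (f a - g m a) - (f a - g n a) := by ring
      rw [this]
      refine (_root_.norm_sub_le _ _).trans ?_
      linarith
    have h0 : Filter.Tendsto (fun N : ℕ => 2 * (2 * (1 / ((N : ℝ) + 1)))) Filter.atTop (nhds 0) := by
      simpa using ((tendsto_one_div_add_atTop_nhds_zero_nat (𝕜 := ℝ)).const_mul 2).const_mul 2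
    have hcau : CauchySeq T := by
      refine cauchySeq_of_le_tendsto_0 _ (fun n m N hn hm => ?_) h0
      rw [dist_eq_norm]
      exact (hT n).norm_sub_le (hg n) (hg m) (hT m) (hgg N n m hn hm)
    obtain ⟨S, hS⟩ := cauchySeq_tendsto_of_complete hcau
    refine ⟨S, fun x => ?_⟩
    have l1 : Filter.Tendsto (fun n => ⟪x, T n x⟫_ℂ) Filter.atTop (nhds ⟪x, S x⟫_ℂ) := by
      have : Continuous fun A : 𝓗 →L[ℂ] 𝓗 => ⟪x, A x⟫_ℂ := by fun_prop
      exact (this.tendsto S).comp hS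
    refine tendsto_nhds_unique l1 ?_
    rw [tendsto_iff_norm_sub_tendsto_zero]
    have h1 : Filter.Tendsto (fun N : ℕ => (1 / ((N : ℝ) + 1)) * ‖x‖ ^ 2) Filter.atTop (nhds 0) := by
      simpa using (tendsto_one_div_add_atTop_nhds_zero_nat (𝕜 := ℝ)).mul_const (‖x‖ ^ 2)
    refine squeeze_zero (fun _ => norm_nonneg _) (fun n => ?_) h1
    rw [hT n x, ← integral_sub (P.integrable_of_bddMeas (hg n) x) (P.integrable_of_bddMeas hf x)]
    exact norm_integral_le P (fun a => by rw [norm_sub_rev]; exact hfg n a) x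

theorem mul_of_approx [CompleteSpace 𝓗] {f g : ℝ → ℂ} {T S : 𝓗 →L[ℂ] 𝓗}
    (hf : BddMeas f) (hg : BddMeas g)
    (happ : ∀ ε > 0, ∃ (f' g' : ℝ → ℂ) (T' S' : 𝓗 →L[ℂ] 𝓗), BddMeas f' ∧ BddMeas g' ∧
      P.Represents (f' * g') (T' ∘L S') ∧ ‖T ∘L S - T' ∘L S'‖ ≤ ε ∧
      ∀ a, ‖f a * g a - f' a * g' a‖ ≤ ε) :
    P.Represents (f * g) (T ∘L S) := by
  intro x
  rw [← sub_eq_zero, ← norm_le_zero_iff]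
  refine le_of_forall_pos_le_add fun δ hδ => ?_
  obtain ⟨f', g', T', S', hf', hg', hrep, hTS, hfg⟩ :=
    happ (δ / (2 * (‖x‖ ^ 2 + 1))) (by positivity)
  set ε := δ / (2 * (‖x‖ ^ 2 + 1))
  have e : ⟪x, (T ∘L S) x⟫_ℂ - ∫ a, (f * g) a ∂P.diag x =
      ⟪x, (T ∘L S - T' ∘L S') x⟫_ℂ - ∫ a, ((f * g) a - (f' * g') a) ∂P.diag x := by
    rw [integral_sub (P.integrable_of_bddMeas (hf.mul hg) x)
      (P.integrable_of_bddMeas (hf'.mul hg') x), ← hrep x, _root_.sub_apply, inner_sub_right]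
    ring
  rw [e]
  refine (_root_.norm_sub_le _ _).trans ?_
  have h1 : ‖⟪x, (T ∘L S - T' ∘L S') x⟫_ℂ‖ ≤ ε * ‖x‖ ^ 2 := by
    refine (norm_inner_le_norm _ _).trans ?_
    have := (T ∘L S - T' ∘L S').le_of_opNorm_le hTS x
    nlinarith [norm_nonneg x]
  have h2 : ‖∫ a, ((f * g) a - (f' * g') a) ∂P.diag x‖ ≤ ε * ‖x‖ ^ 2 := norm_integral_le P hfg x
  have h3 : ε * ‖x‖ ^ 2 ≤ δ / 2 := by
    rw [div_mul_eq_mul_div, div_le_div_iff₀ (by positivity) (by positivity)]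
    nlinarith
  linarith

/-- The calculus is multiplicative. -/
theorem mul [CompleteSpace 𝓗] {f g : ℝ → ℂ} (hf : BddMeas f) (hg : BddMeas g)
    {T S : 𝓗 →L[ℂ] 𝓗} (hT : P.Represents f T) (hS : P.Represents g S) :
    P.Represents (f * g) (T ∘L S) := by
  induction hf using BddMeas.induction generalizing T with
  | ind A hA c =>
    obtain rfl := hT.unique (indicator P hA c)
    clear hT
    induction hg using BddMeas.induction generalizing S with
    | ind B hB d =>
      obtain rfl := hS.unique (indicator P hB d)
      have := indicator P (hA.inter hB) (c * d)
      convert this using 1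
      · ext a
        by_cases h1 : a ∈ A <;> by_cases h2 : a ∈ B <;> simp [h1, h2]
      · rw [← P.proj_comp A B hA hB]
        ext x; simp [smul_smul, mul_comm]
    | add g g' hg hg' h1 h2 =>
      obtain ⟨U, hU⟩ := exists_of_bddMeas P hg
      obtain ⟨V, hV⟩ := exists_of_bddMeas P hg'
      obtain rfl := hS.unique (hU.add hg hg' hV)
      rw [mul_add, ContinuousLinearMap.comp_add]
      exact (h1 hU).add ((BddMeas.indicator_const hA c).mul hg)
        ((BddMeas.indicator_const hA c).mul hg') (h2 hV)
    | lim g hg h =>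
      refine mul_of_approx (BddMeas.indicator_const hA c) hg fun ε hε => ?_
      set M := 2 * ‖c • P.proj A‖ + ‖c‖ + 1 with hM
      have hMpos : 0 < M := by positivity
      obtain ⟨g', hg', h1, h2⟩ := h (ε / M) (by positivity)
      obtain ⟨U, hU⟩ := exists_of_bddMeas P hg'
      refine ⟨_, g', _, U, BddMeas.indicator_const hA c, hg', h1 hU, ?_, fun a => ?_⟩
      · rw [← ContinuousLinearMap.comp_sub]
        refine (ContinuousLinearMap.opNorm_comp_le _ _).trans ?_
        have h3 := hS.norm_sub_le hg hg' hU h2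
        calc _ ≤ ‖c • P.proj A‖ * (2 * (ε / M)) := by gcongr
          _ = (2 * ‖c • P.proj A‖) * (ε / M) := by ring
          _ ≤ M * (ε / M) := by gcongr; linarith [norm_nonneg c]
          _ = ε := by field_simp
      · rw [← mul_sub, norm_mul]
        calc _ ≤ ‖c‖ * (ε / M) := by
              gcongr
              · exact norm_indicator_le_norm_self _ a
              · exact h2 a
          _ ≤ M * (ε / M) := by gcongr; linarith [norm_nonneg (c • P.proj A)]
          _ = ε := by field_simp
  | add f f' hf hf' h1 h2 =>
    obtain ⟨U, hU⟩ := exists_of_bddMeas P hf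
    obtain ⟨V, hV⟩ := exists_of_bddMeas P hf'
    obtain rfl := hT.unique (hU.add hf hf' hV)
    rw [add_mul, ContinuousLinearMap.add_comp]
    exact (h1 hU).add (hf.mul hg) (hf'.mul hg) (h2 hV)
  | lim f hf h =>
    refine mul_of_approx hf hg fun ε hε => ?_
    obtain ⟨c, hc⟩ := hg.2
    have hc0 : 0 ≤ c := (norm_nonneg _).trans (hc 0)
    set M := 2 * ‖S‖ + c + 1 with hM
    have hMpos : 0 < M := by positivity
    obtain ⟨f', hf', h1, h2⟩ := h (ε / M) (by positivity)
    obtain ⟨U, hU⟩ := exists_of_bddMeas P hf'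
    refine ⟨f', _, U, S, hf', hg, h1 hU, ?_, fun a => ?_⟩
    · rw [← ContinuousLinearMap.sub_comp]
      refine (ContinuousLinearMap.opNorm_comp_le _ _).trans ?_
      have h3 := hT.norm_sub_le hf hf' hU h2
      calc _ ≤ (2 * (ε / M)) * ‖S‖ := by gcongr
        _ = (2 * ‖S‖) * (ε / M) := by ring
        _ ≤ M * (ε / M) := by gcongr; linarith
        _ = ε := by field_simp
    · rw [← sub_mul, norm_mul]
      calc _ ≤ (ε / M) * c := by
            gcongr
            · exact h2 a
            · exact hc a
        _ = c * (ε / M) := by ring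
        _ ≤ M * (ε / M) := by gcongr; linarith [norm_nonneg S]
        _ = ε := by field_simp

theorem adjoint [CompleteSpace 𝓗] {f : ℝ → ℂ} {T : 𝓗 →L[ℂ] 𝓗} (hT : P.Represents f T) :
    P.Represents (fun a => (starRingEnd ℂ) (f a)) T.adjoint := by
  intro x
  rw [ContinuousLinearMap.adjoint_inner_right, ← inner_conj_symm, hT x, integral_conj]

theorem isSelfAdjoint [CompleteSpace 𝓗] {f : ℝ → ℝ} {T : 𝓗 →L[ℂ] 𝓗}
    (hT : P.Represents (fun a => (f a : ℂ)) T) : IsSelfAdjoint T := by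
  rw [ContinuousLinearMap.isSelfAdjoint_iff']
  refine unique hT.adjoint ?_
  simpa using hT

theorem norm_sq_apply [CompleteSpace 𝓗] {f : ℝ → ℂ} (hf : BddMeas f) {T : 𝓗 →L[ℂ] 𝓗}
    (hT : P.Represents f T) (x : 𝓗) : ‖T x‖ ^ 2 = ∫ a, ‖f a‖ ^ 2 ∂P.diag x := by
  have h := hT.adjoint.mul hf.conj hf hT x
  rw [ContinuousLinearMap.comp_apply, ContinuousLinearMap.adjoint_inner_right,
    inner_self_eq_norm_sq_to_K] at h
  have e : ∀ a, ((fun a => (starRingEnd ℂ) (f a)) * f) a = ((‖f a‖ ^ 2 : ℝ) : ℂ) := by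
    intro a
    rw [Pi.mul_apply, Complex.conj_mul']
    push_cast; rfl
  simp_rw [e] at h
  rw [integral_complex_ofReal] at h
  apply Complex.ofReal_injective
  rw [← h]
  simp

theorem norm_le [CompleteSpace 𝓗] {f : ℝ → ℂ} (hf : BddMeas f) {T : 𝓗 →L[ℂ] 𝓗}
    (hT : P.Represents f T) {c : ℝ} (hc : ∀ a, ‖f a‖ ≤ c) : ‖T‖ ≤ c := by
  have hc0 : 0 ≤ c := (norm_nonneg _).trans (hc 0)
  refine ContinuousLinearMap.opNorm_le_bound _ hc0 fun x => ?_
  rw [← abs_of_nonneg (norm_nonneg (T x)), ← abs_of_nonneg (mul_nonneg hc0 (norm_nonneg x)),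
    ← sq_le_sq, hT.norm_sq_apply hf]
  have := norm_integral_le_of_norm_le_const (μ := P.diag x) (f := fun a => ‖f a‖ ^ 2)
    (C := c ^ 2) (Filter.Eventually.of_forall fun a => by
      rw [norm_pow, norm_norm]; gcongr; exact hc a)
  rw [P.diag_real_univ] at this
  rw [mul_pow]
  exact (le_abs_self _).trans this

/-- Strong continuity of `t ↦ ∫ F t dP` for a pointwise continuous bounded family. -/
theorem continuous_apply [CompleteSpace 𝓗] {F : ℝ → ℝ → ℂ} (hm : ∀ t, Measurable (F t)) {c : ℝ}
    (hc : ∀ t a, ‖F t a‖ ≤ c) (hF : ∀ a, Continuous fun t => F t a) {T : ℝ → 𝓗 →L[ℂ] 𝓗}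
    (hT : ∀ t, P.Represents (F t) (T t)) (x : 𝓗) : Continuous fun t => T t x := by
  have hb : ∀ t, BddMeas (F t) := fun t => ⟨hm t, c, hc t⟩
  rw [continuous_iff_continuousAt]
  intro s
  have hlim : Filter.Tendsto (fun t => ∫ a, ‖F t a - F s a‖ ^ 2 ∂P.diag x) (nhds s) (nhds 0) := by
    have : Filter.Tendsto (fun t => ∫ a, ‖F t a - F s a‖ ^ 2 ∂P.diag x) (nhds s)
        (nhds (∫ a, (0 : ℝ) ∂P.diag x)) := by
      refine tendsto_integral_filter_of_dominated_convergence (fun _ => (2 * c) ^ 2)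
        (Filter.Eventually.of_forall fun t =>
          (((hm t).sub (hm s)).norm.pow_const 2).aestronglyMeasurable)
        (Filter.Eventually.of_forall fun t => Filter.Eventually.of_forall fun a => ?_)
        (integrable_const _) (Filter.Eventually.of_forall fun a => ?_)
      · rw [norm_pow, norm_norm]
        gcongr
        refine (_root_.norm_sub_le _ _).trans ?_
        linarith [hc t a, hc s a]
      · have : Continuous fun t => ‖F t a - F s a‖ ^ 2 := by have := hF a; fun_prop
        simpa using this.tendsto s
    simpa using this
  rw [ContinuousAt, tendsto_iff_norm_sub_tendsto_zero]
  have h2 : ∀ t, ‖T t x - T s x‖ ^ 2 = ∫ a, ‖F t a - F s a‖ ^ 2 ∂P.diag x := fun t => by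
    have := ((hT t).sub (hb t) (hb s) (hT s)).norm_sq_apply ((hb t).sub (hb s)) x
    simpa using this
  simp_rw [← h2] at hlim
  have := (Real.continuous_sqrt.tendsto 0).comp hlim
  simpa [Function.comp_def, Real.sqrt_sq] using this

end Represents
end SpectralData

/-! ### Finite-rank perturbations and quadratic pencils -/

section FiniteRank

variable {E F G : Type*} [NormedAddCommGroup E] [NormedSpace ℂ E] [NormedAddCommGroup F]
  [NormedSpace ℂ F] [NormedAddCommGroup G] [NormedSpace ℂ G]

theorem finiteRankOp_zero : FiniteRankOp (0 : E →L[ℂ] F) := by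
  unfold FiniteRankOp
  rw [ContinuousLinearMap.toLinearMap_zero, LinearMap.range_zero]
  infer_instance

theorem FiniteRankOp.comp_left {A : E →L[ℂ] F} (hA : FiniteRankOp A) (B : F →L[ℂ] G) :
    FiniteRankOp (B ∘L A) := by
  unfold FiniteRankOp at *
  rw [ContinuousLinearMap.toLinearMap_comp, LinearMap.range_comp]
  infer_instance

theorem FiniteRankOp.comp_right {A : F →L[ℂ] G} (hA : FiniteRankOp A) (B : E →L[ℂ] F) :
    FiniteRankOp (A ∘L B) := by
  unfold FiniteRankOp at *
  rw [ContinuousLinearMap.toLinearMap_comp]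
  exact Submodule.finiteDimensional_of_le (LinearMap.range_comp_le_range _ _)

theorem FiniteRankOp.smul {A : E →L[ℂ] F} (hA : FiniteRankOp A) (c : ℂ) :
    FiniteRankOp (c • A) := by
  have := hA.comp_left (c • ContinuousLinearMap.id ℂ F)
  simpa using this

theorem FiniteRankOp.add {A B : E →L[ℂ] F} (hA : FiniteRankOp A) (hB : FiniteRankOp B) :
    FiniteRankOp (A + B) := by
  unfold FiniteRankOp at *
  rw [ContinuousLinearMap.toLinearMap_add]
  exact Submodule.finiteDimensional_of_le (LinearMap.range_add_le _ _)

/-- The Fredholm alternative for finite-rank perturbations of the identity. -/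
theorem isUnit_one_add_of_finiteRank [CompleteSpace E] {K : E →L[ℂ] E} (hK : FiniteRankOp K)
    (hinj : ∀ x, x + K x = 0 → x = 0) : IsUnit (1 + K) := by
  rw [ContinuousLinearMap.isUnit_iff_bijective]
  have hi : Function.Injective (1 + K : E →L[ℂ] E) := by
    rw [injective_iff_map_eq_zero]
    exact fun x hx => hinj x hx
  refine ⟨hi, fun y => ?_⟩
  set R := LinearMap.range (K : E →ₗ[ℂ] E)
  have : FiniteDimensional ℂ R := hK
  have hmem : ∀ x, K x ∈ R := fun x => ⟨x, rfl⟩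
  let T : R →ₗ[ℂ] R := ((1 + K : E →L[ℂ] E) : E →ₗ[ℂ] E).restrict
    (fun x hx => R.add_mem hx (hmem x))
  have hT : Function.Injective T := by
    intro a b hab
    apply Subtype.ext
    apply hi
    exact congrArg Subtype.val hab
  obtain ⟨r, hr⟩ := (LinearMap.injective_iff_surjective.1 hT) ⟨-K y, R.neg_mem (hmem y)⟩
  refine ⟨y + r, ?_⟩
  have h1 : (r : E) + K r = -K y := congrArg Subtype.val hr
  show (y + r) + K (y + r) = y
  rw [map_add, add_add_add_comm, h1]
  abel

theorem isUnit_add_of_finiteRank [CompleteSpace E] {U K : E →L[ℂ] E} (hU : IsUnit U)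
    (hK : FiniteRankOp K) (hinj : ∀ x, (U + K) x = 0 → x = 0) : IsUnit (U + K) := by
  obtain ⟨u, rfl⟩ := hU
  have e : (u : E →L[ℂ] E) + K = u * (1 + (↑u⁻¹ : E →L[ℂ] E) * K) := by
    rw [mul_add, mul_one, ← mul_assoc, Units.mul_inv, one_mul]
  rw [e]
  refine u.isUnit.mul (isUnit_one_add_of_finiteRank (hK.comp_left _) fun x hx => hinj x ?_)
  rw [e, mul_apply_eq_comp]
  exact (congrArg u.1 hx).trans (map_zero _)

end FiniteRank

/-- The spectral projection at the eigenvalue `1` of a self-adjoint finite-rank perturbation of a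
strict contraction. -/
theorem exists_eigenprojection [CompleteSpace 𝓗] {S S₁ F : 𝓗 →L[ℂ] 𝓗} (hS : IsSelfAdjoint S)
    (hsum : S = S₁ + F) (h1 : ‖S₁‖ < 1) (hF : FiniteRankOp F) :
    ∃ E : 𝓗 →L[ℂ] 𝓗, FiniteRankOp E ∧ E * E = E ∧ S * E = E ∧ E * S = E ∧
      IsUnit (S - 1 + E) := by
  obtain ⟨u, hu⟩ := isUnit_one_sub_of_norm_lt_one h1
  set N := LinearMap.ker ((S - 1 : 𝓗 →L[ℂ] 𝓗) : 𝓗 →ₗ[ℂ] 𝓗) with hN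
  have hmemN : ∀ x, x ∈ N ↔ S x = x := by
    intro x
    rw [hN, LinearMap.mem_ker]
    exact sub_eq_zero
  have hfin : FiniteDimensional ℂ N := by
    have h2 : FiniteRankOp ((↑u⁻¹ : 𝓗 →L[ℂ] 𝓗) ∘L F) := hF.comp_left _
    unfold FiniteRankOp at h2
    refine Submodule.finiteDimensional_of_le (S₂ := LinearMap.range
      (((↑u⁻¹ : 𝓗 →L[ℂ] 𝓗) ∘L F : 𝓗 →L[ℂ] 𝓗) : 𝓗 →ₗ[ℂ] 𝓗)) fun x hx => ⟨x, ?_⟩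
    rw [hmemN, hsum] at hx
    have h3 : F x = (u : 𝓗 →L[ℂ] 𝓗) x := by
      rw [hu]
      show F x = x - S₁ x
      rw [eq_sub_iff_add_eq, add_comm]
      exact hx
    show (↑u⁻¹ : 𝓗 →L[ℂ] 𝓗) (F x) = x
    rw [h3, ← mul_apply_eq_comp, Units.inv_mul]
    rfl
  set E := N.starProjection with hE
  have hsa : IsSelfAdjoint E := isSelfAdjoint_starProjection N
  have hEE : E * E = E := N.isIdempotentElem_starProjection
  have hSE : S * E = E := by
    ext x
    exact (hmemN _).1 (N.starProjection_apply_mem x)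
  have hES : E * S = E := by
    have := congrArg star hSE
    rwa [star_mul, hS.star_eq, hsa.star_eq] at this
  have hEf : FiniteRankOp E := by
    unfold FiniteRankOp
    refine Submodule.finiteDimensional_of_le (S₂ := N) ?_
    rintro _ ⟨x, rfl⟩
    exact N.starProjection_apply_mem x
  refine ⟨E, hEf, hEE, hSE, hES, ?_⟩
  have e : S - 1 + E = -(u : 𝓗 →L[ℂ] 𝓗) + (F + E) := by
    rw [hu, hsum]; abel
  rw [e]
  refine isUnit_add_of_finiteRank u.isUnit.neg (hF.add hEf) fun x hx => ?_
  rw [← e] at hx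
  have h2 : E x = 0 := by
    have h3 := congrArg E hx
    have h4 : E * (S - 1 + E) = E := by
      rw [mul_add, mul_sub, hES, hEE, mul_one, sub_self, zero_add]
    rw [map_zero, ← mul_apply_eq_comp, h4] at h3
    exact h3
  have h5 : S x = x := by
    have : S x - x + E x = 0 := hx
    rwa [h2, add_zero, sub_eq_zero] at this
  have h6 : E x = x := Submodule.starProjection_eq_self_iff.2 ((hmemN x).2 h5)
  rw [← h6, h2]

section Algebra

variable {A : Type*} [Ring A] [Algebra ℂ A]

/-- The resolvent in terms of the reduced resolvent at an eigenvalue. -/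
theorem inverse_eq_of_eigenprojection {B E : A} {ζ ζ₀ : ℂ} (hζ₀ : ζ₀ ≠ 0) (hζ : ζ ≠ ζ₀)
    (hEE : E * E = E) (hBE : (ζ₀ • B) * E = E) (hEB : E * (ζ₀ • B) = E)
    (hu : IsUnit (ζ • B - 1 + E)) :
    IsUnit (ζ • B - 1) ∧ Ring.inverse (ζ • B - 1) =
      Ring.inverse (ζ • B - 1 + E) * (1 - E) + (ζ - ζ₀)⁻¹ • (ζ₀ • E) := by
  obtain ⟨u, hu⟩ := hu
  have hc : ζ - ζ₀ ≠ 0 := sub_ne_zero.2 hζ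
  have h1 : (ζ • B) * E = (ζ / ζ₀) • E := by
    conv_rhs => rw [← hBE]
    rw [smul_mul_assoc, smul_mul_assoc, smul_smul, div_mul_cancel₀ _ hζ₀]
  have h2 : E * (ζ • B) = (ζ / ζ₀) • E := by
    conv_rhs => rw [← hEB]
    rw [mul_smul_comm, mul_smul_comm, smul_smul, div_mul_cancel₀ _ hζ₀]
  have hcomm : Commute (u : A) E := by
    rw [hu]
    show (ζ • B - 1 + E) * E = E * (ζ • B - 1 + E)
    simp only [add_mul, sub_mul, mul_add, mul_sub, h1, h2, one_mul, mul_one]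
  have hcomm' : (↑u⁻¹ : A) * E = E * ↑u⁻¹ := hcomm.units_inv_left
  set T := ζ • B - 1 with hT
  have hTE : T * E = (ζ / ζ₀ - 1) • E := by rw [hT, sub_mul, h1, one_mul, sub_smul, one_smul]
  have hET : E * T = (ζ / ζ₀ - 1) • E := by rw [hT, mul_sub, h2, mul_one, sub_smul, one_smul]
  have hs : (ζ - ζ₀)⁻¹ * ζ₀ * (ζ / ζ₀ - 1) = 1 := by field_simp
  have hTu : T = u - E := by rw [hu]; abel
  have r : T * (↑u⁻¹ * (1 - E) + (ζ - ζ₀)⁻¹ • (ζ₀ • E)) = 1 := by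
    rw [mul_add, smul_smul, mul_smul_comm, hTE, smul_smul, hs, one_smul]
    have : T * (↑u⁻¹ * (1 - E)) = 1 - E := by
      have e : (↑u⁻¹ : A) * (1 - E) = (1 - E) * ↑u⁻¹ := by
        rw [mul_sub, sub_mul, hcomm', one_mul, mul_one]
      have e2 : T * (1 - E) = u * (1 - E) := by
        rw [hTu, sub_mul, mul_sub E, hEE, mul_one, sub_self, sub_zero]
      rw [e, ← mul_assoc, e2, mul_assoc, ← e, ← mul_assoc, Units.mul_inv, one_mul]
    rw [this, sub_add_cancel]
  have l : (↑u⁻¹ * (1 - E) + (ζ - ζ₀)⁻¹ • (ζ₀ • E)) * T = 1 := by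
    rw [add_mul, smul_smul, smul_mul_assoc, hET, smul_smul, hs, one_smul]
    have : ↑u⁻¹ * (1 - E) * T = 1 - E := by
      have e2 : (1 - E) * T = u * (1 - E) := by
        rw [hTu, mul_sub, sub_mul 1 E E, hEE, one_mul, sub_self, sub_zero, sub_mul, mul_sub,
          one_mul, mul_one, hcomm.eq]
      rw [mul_assoc, e2, ← mul_assoc, Units.inv_mul, one_mul]
    rw [this, sub_add_cancel]
  let v : Aˣ := ⟨T, _, r, l⟩
  refine ⟨⟨v, rfl⟩, ?_⟩
  rw [← hu, Ring.inverse_unit]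
  exact Ring.inverse_unit v

end Algebra

open scoped ComplexOrder in
theorem spectrum_re_nonneg [CompleteSpace 𝓗] {B : 𝓗 →L[ℂ] 𝓗} (hB : 0 ≤ B) {ζ : ℂ}
    (hζ : ζ ∈ spectrum ℂ B) : 0 ≤ ζ.re := by
  have : (0 : ℂ) ≤ ζ := spectrum_nonneg_of_nonneg hB hζ
  exact (Complex.le_def.1 this).1

theorem isUnit_smul_sub_one [CompleteSpace 𝓗] {B : 𝓗 →L[ℂ] 𝓗} (hB : 0 ≤ B) {ζ : ℂ}
    (hζ : ζ.im ≠ 0 ∨ ζ.re ≤ 0) : IsUnit (ζ • B - 1) := by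
  by_cases h0 : ζ = 0
  · simp [h0]
  have h1 : ζ⁻¹ ∉ spectrum ℂ B := by
    intro hmem
    have hre := (IsSelfAdjoint.of_nonneg hB).mem_spectrum_eq_re hmem
    have hnn : (0 : ℝ) ≤ (ζ⁻¹).re := spectrum_re_nonneg hB hmem
    have him : (ζ⁻¹).im = 0 := by rw [hre]; simp
    have hn : 0 < Complex.normSq ζ := Complex.normSq_pos.2 h0
    rw [Complex.inv_im, _root_.div_eq_zero_iff] at him
    rw [Complex.inv_re] at hnn
    have him' : ζ.im = 0 := by
      rcases him with h | h
      · linarith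
      · exact absurd h hn.ne'
    rcases hζ with h | h
    · exact h him'
    · have h3 : 0 ≤ ζ.re := by
        by_contra hlt
        exact absurd hnn (not_le.2 (div_neg_of_neg_of_pos (not_le.1 hlt) hn))
      exact h0 (Complex.ext (le_antisymm h h3) him')
  rw [spectrum.notMem_iff] at h1
  have e : ζ • B - 1 = (-ζ) • ((algebraMap ℂ (𝓗 →L[ℂ] 𝓗)) ζ⁻¹ - B) := by
    rw [Algebra.algebraMap_eq_smul_one, smul_sub, smul_smul, neg_mul, mul_inv_cancel₀ h0,
      neg_smul, neg_smul, one_smul]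
    abel
  rw [e]
  exact h1.smul (Units.mk0 (-ζ) (neg_ne_zero.2 h0))

/-- A positive operator bounded below by `1` is normalized by a self-adjoint invertible
contraction. -/
theorem exists_normalizer [CompleteSpace 𝓗] {W : 𝓗 →L[ℂ] 𝓗} (hW : 1 ≤ W) :
    ∃ M : 𝓗 →L[ℂ] 𝓗, IsSelfAdjoint M ∧ IsUnit M ∧ M * W * M = 1 ∧ ‖M‖ ≤ 1 := by
  have hWu : IsUnit W := CStarAlgebra.isUnit_of_le 1 hW isStrictlyPositive_one
  obtain ⟨w, rfl⟩ := hWu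
  have hinv0 : (0 : 𝓗 →L[ℂ] 𝓗) ≤ ↑w⁻¹ :=
    CFC.inv_nonneg_of_nonneg w (zero_le_one.trans hW)
  have hinv1 : (↑w⁻¹ : 𝓗 →L[ℂ] 𝓗) ≤ 1 := CStarAlgebra.inv_le_one hW
  set M := CFC.sqrt (↑w⁻¹ : 𝓗 →L[ℂ] 𝓗) with hM
  have hMM : M * M = ↑w⁻¹ := CFC.sqrt_mul_sqrt_self _ hinv0
  have hMu : IsUnit M := (CFC.isUnit_sqrt_iff _ hinv0).2 w⁻¹.isUnit
  have hMsa : IsSelfAdjoint M := IsSelfAdjoint.of_nonneg (CFC.sqrt_nonneg _)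
  refine ⟨M, hMsa, hMu, ?_, ?_⟩
  · have h1 : M * (M * w) = 1 := by rw [← mul_assoc, hMM, Units.inv_mul]
    obtain ⟨m, hm⟩ := hMu
    rw [← hm] at h1 ⊢
    rw [← Units.inv_eq_of_mul_eq_one_right h1, Units.inv_mul]
  · have h1 : ‖M‖ * ‖M‖ ≤ 1 := by
      rw [← CStarRing.norm_star_mul_self, hMsa.star_eq, hMM]
      exact (CStarAlgebra.norm_le_one_iff_of_nonneg _ hinv0).2 hinv1
    nlinarith [norm_nonneg M]

theorem isUnit_pencil_of_normalizer {A : Type*} [Ring A] [Algebra ℂ A] {M W Q : A}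
    (hM : IsUnit M) (hMW : M * W * M = 1) {ζ : ℂ} (h : IsUnit (ζ • (M * Q * M) - 1)) :
    IsUnit (ζ • Q - W) ∧
      Ring.inverse (ζ • Q - W) = M * Ring.inverse (ζ • (M * Q * M) - 1) * M := by
  obtain ⟨m, rfl⟩ := hM
  obtain ⟨v, hv⟩ := h
  have e : ζ • Q - W = ↑m⁻¹ * v * ↑m⁻¹ := by
    have : (v : A) = m * (ζ • Q - W) * m := by
      rw [hv, mul_sub, sub_mul, hMW, mul_smul_comm, smul_mul_assoc]
    rw [this, mul_assoc, mul_assoc, mul_assoc, Units.mul_inv, mul_one, ← mul_assoc,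
      Units.inv_mul, one_mul]
  refine ⟨e ▸ (m⁻¹ * v * m⁻¹).isUnit, ?_⟩
  have e2 : ζ • Q - W = ((m⁻¹ * v * m⁻¹ : Aˣ) : A) := e
  rw [e2, Ring.inverse_unit, ← hv, Ring.inverse_unit]
  simp [mul_inv_rev, mul_assoc]

theorem isUnit_pencil [CompleteSpace 𝓗] {Q W : 𝓗 →L[ℂ] 𝓗} (hQ : 0 ≤ Q) (hW : 1 ≤ W) {ζ : ℂ}
    (hζ : ζ.im ≠ 0 ∨ ζ.re ≤ 0) : IsUnit (ζ • Q - W) := by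
  obtain ⟨M, hMsa, hMu, hMW, -⟩ := exists_normalizer hW
  exact (isUnit_pencil_of_normalizer hMu hMW
    (isUnit_smul_sub_one (hMsa.conjugate_nonneg hQ) hζ)).1

/-- Below the essential spectrum the inverse of the pencil `ζ Q - W` has at most simple poles with
finite-rank residues. -/
theorem pencil_inverse_near [CompleteSpace 𝓗] {Q W R F : 𝓗 →L[ℂ] 𝓗} (hQ : 0 ≤ Q) (hW : 1 ≤ W)
    {r : ℝ} (hr : 0 < r) (hsum : Q = R + F) (hF : FiniteRankOp F) (hR : r * ‖R‖ < 1) :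
    ∃ (C : 𝓗 →L[ℂ] 𝓗) (G : ℂ → 𝓗 →L[ℂ] 𝓗), FiniteRankOp C ∧ AnalyticAt ℂ G r ∧
      ∀ᶠ ζ in nhdsWithin (r : ℂ) {(r : ℂ)}ᶜ, IsUnit (ζ • Q - W) ∧
        Ring.inverse (ζ • Q - W) = G ζ + (ζ - r)⁻¹ • C := by
  obtain ⟨M, hMsa, hMu, hMW, hM1⟩ := exists_normalizer hW
  set B := M * Q * M with hB
  have hBsa : IsSelfAdjoint B := IsSelfAdjoint.of_nonneg (hMsa.conjugate_nonneg hQ)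
  have hr0 : (r : ℂ) ≠ 0 := by exact_mod_cast hr.ne'
  have hS : IsSelfAdjoint ((r : ℂ) • B) := by
    rw [isSelfAdjoint_iff, star_smul, hBsa.star_eq]
    simp
  have hS1 : ‖(r : ℂ) • (M * R * M)‖ < 1 := by
    rw [norm_smul, Complex.norm_real, Real.norm_of_nonneg hr.le]
    have h1 : ‖M * R * M‖ ≤ ‖R‖ := by
      calc ‖M * R * M‖ ≤ ‖M‖ * ‖R‖ * ‖M‖ :=
            (norm_mul_le _ _).trans (mul_le_mul_of_nonneg_right (norm_mul_le _ _) (norm_nonneg _))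
        _ ≤ 1 * ‖R‖ * 1 := by gcongr
        _ = ‖R‖ := by ring
    exact (mul_le_mul_of_nonneg_left h1 hr.le).trans_lt hR
  have hS2 : (r : ℂ) • B = (r : ℂ) • (M * R * M) + (r : ℂ) • (M * F * M) := by
    rw [← smul_add, hB, hsum, mul_add, add_mul]
  obtain ⟨E, hEf, hEE, hSE, hES, hu⟩ := exists_eigenprojection hS hS2 hS1
    (((hF.comp_left M).comp_right M).smul _)
  have hlin : ∀ ζ : ℂ, AnalyticAt ℂ (fun ζ : ℂ => ζ • B - 1 + E) ζ := fun ζ => by fun_prop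
  have hinv : AnalyticAt ℂ (fun ζ : ℂ => Ring.inverse (ζ • B - 1 + E)) r := by
    obtain ⟨u, hu⟩ := hu
    have h1 : AnalyticAt ℂ (Ring.inverse : (𝓗 →L[ℂ] 𝓗) → _) ((r : ℂ) • B - 1 + E) := by
      rw [← hu]; exact analyticAt_inverse u
    exact h1.fun_comp (f := fun ζ : ℂ => ζ • B - 1 + E) (hlin r)
  refine ⟨M * ((r : ℂ) • E) * M, fun ζ => M * (Ring.inverse (ζ • B - 1 + E) * (1 - E)) * M,
    ((hEf.smul _).comp_left M).comp_right M, by fun_prop, ?_⟩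
  have hev : ∀ᶠ ζ in nhds (r : ℂ), IsUnit (ζ • B - 1 + E) :=
    (hlin r).continuousAt.eventually_mem (Units.isOpen.mem_nhds hu)
  filter_upwards [hev.filter_mono nhdsWithin_le_nhds, self_mem_nhdsWithin] with ζ h1 h2
  obtain ⟨h3, h4⟩ := inverse_eq_of_eigenprojection hr0 h2 hEE hSE hES h1
  obtain ⟨h5, h6⟩ := isUnit_pencil_of_normalizer hMu hMW h3
  refine ⟨h5, ?_⟩
  rw [h6, h4, mul_add, add_mul, mul_smul_comm, smul_mul_assoc]

/-! ### Positivity of the Coulomb energy -/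

/-- A kernel that is a superposition of products `φ a y * φ a y'` is positive definite. -/
theorem integral_conj_mul_kernel_eq {A Y : Type*} [MeasurableSpace A] [MeasurableSpace Y]
    (ν : Measure A) [SFinite ν] (μ : Measure Y) [SFinite μ] {φ : A → Y → ℝ}
    (hφ : Measurable (Function.uncurry φ)) (hφ0 : ∀ a y, 0 ≤ φ a y) {k : Y × Y → ℝ}
    (hk : ∀ᵐ p ∂μ.prod μ, Integrable (fun a => φ a p.1 * φ a p.2) ν ∧
      ∫ a, φ a p.1 * φ a p.2 ∂ν = k p)
    {ρ : Y → ℂ} (hρ : AEStronglyMeasurable ρ μ)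
    (hint : Integrable (fun p => ‖ρ p.1‖ * ‖ρ p.2‖ * k p) (μ.prod μ)) :
    ∫ p, starRingEnd ℂ (ρ p.2) * ρ p.1 * (k p : ℂ) ∂μ.prod μ =
      ((∫ a, ‖∫ y, (φ a y : ℂ) * ρ y ∂μ‖ ^ 2 ∂ν : ℝ) : ℂ) := by
  set F : (Y × Y) × A → ℂ := fun q =>
    starRingEnd ℂ (ρ q.1.2) * ρ q.1.1 * ((φ q.2 q.1.1 * φ q.2 q.1.2 : ℝ) : ℂ) with hF
  have hρ1 : AEStronglyMeasurable (fun q : (Y × Y) × A => ρ q.1.1) ((μ.prod μ).prod ν) :=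
    (hρ.comp_fst (ν := μ)).comp_fst
  have hρ2 : AEStronglyMeasurable (fun q : (Y × Y) × A => starRingEnd ℂ (ρ q.1.2))
      ((μ.prod μ).prod ν) :=
    continuous_conj.comp_aestronglyMeasurable ((hρ.comp_snd (μ := μ)).comp_fst)
  have hφ1 : Measurable fun q : (Y × Y) × A => φ q.2 q.1.1 :=
    hφ.comp (measurable_snd.prodMk (measurable_fst.comp measurable_fst))
  have hφ2 : Measurable fun q : (Y × Y) × A => φ q.2 q.1.2 :=
    hφ.comp (measurable_snd.prodMk (measurable_snd.comp measurable_fst))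
  have hFm : AEStronglyMeasurable F ((μ.prod μ).prod ν) :=
    (hρ2.mul hρ1).mul (Complex.measurable_ofReal.comp (hφ1.mul hφ2)).aestronglyMeasurable
  have hFi : Integrable F ((μ.prod μ).prod ν) := by
    refine (integrable_prod_iff hFm).2 ⟨?_, ?_⟩
    · filter_upwards [hk] with p hp
      exact (hp.1.ofReal (𝕜 := ℂ)).const_mul (starRingEnd ℂ (ρ p.2) * ρ p.1)
    · refine hint.congr ?_
      filter_upwards [hk] with p hp
      have : ∀ a, ‖F (p, a)‖ = ‖ρ p.1‖ * ‖ρ p.2‖ * (φ a p.1 * φ a p.2) := fun a => by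
        simp only [hF]
        rw [norm_mul, norm_mul, RCLike.norm_conj, Complex.norm_real,
          Real.norm_of_nonneg (mul_nonneg (hφ0 _ _) (hφ0 _ _)), mul_comm ‖ρ p.2‖]
      simp only [this]
      rw [integral_const_mul, hp.2]
  have h1 : ∫ q, F q ∂(μ.prod μ).prod ν =
      ∫ p, starRingEnd ℂ (ρ p.2) * ρ p.1 * (k p : ℂ) ∂μ.prod μ := by
    rw [integral_prod _ hFi]
    refine integral_congr_ae ?_
    filter_upwards [hk] with p hp
    simp only [hF]
    rw [integral_const_mul, integral_complex_ofReal, hp.2]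
  rw [← h1, integral_prod_symm _ hFi, ← integral_complex_ofReal]
  refine integral_congr_ae (Filter.Eventually.of_forall fun a => ?_)
  have h2 : ∀ p : Y × Y, F (p, a) =
      ((φ a p.1 : ℂ) * ρ p.1) * (starRingEnd ℂ ((φ a p.2 : ℂ) * ρ p.2)) := by
    intro p
    simp only [hF, map_mul, Complex.conj_ofReal, Complex.ofReal_mul]
    ring
  simp only [h2]
  rw [integral_prod_mul (fun y => (φ a y : ℂ) * ρ y)
    (fun y => starRingEnd ℂ ((φ a y : ℂ) * ρ y)), integral_conj, Complex.mul_conj,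
    Complex.normSq_eq_norm_sq]

/-- The Gaussians whose superposition is the Coulomb kernel. -/
def coulombGaussian (a : ℝ × R3) (y : R3) : ℝ :=
  √(a.1 ^ 3) * Real.exp (-a.1 ^ 2 * ‖y - a.2‖ ^ 2)

theorem measurable_coulombGaussian : Measurable (Function.uncurry coulombGaussian) := by
  unfold coulombGaussian Function.uncurry
  fun_prop

theorem coulombGaussian_nonneg (a : ℝ × R3) (y : R3) : 0 ≤ coulombGaussian a y := by
  unfold coulombGaussian; positivity

theorem coulombGaussian_mul {t : ℝ} (ht : 0 < t) (u y y' : R3) :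
    coulombGaussian (t, u) y * coulombGaussian (t, u) y' =
      t ^ 3 * Real.exp (-(‖y - y'‖ ^ 2 / 2) * t ^ 2) *
        Real.exp (-(2 * t ^ 2) * ‖u - (1 / 2 : ℝ) • (y + y')‖ ^ 2) := by
  have hpar : ‖y - u‖ ^ 2 + ‖y' - u‖ ^ 2 =
      2 * ‖u - (1 / 2 : ℝ) • (y + y')‖ ^ 2 + ‖y - y'‖ ^ 2 / 2 := by
    have h := parallelogram_law_with_norm ℝ (y - u) (y' - u)
    have e1 : (y - u) - (y' - u) = y - y' := by abel
    have e2 : (y - u) + (y' - u) = (-2 : ℝ) • (u - (1 / 2 : ℝ) • (y + y')) := by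
      module
    rw [e1, e2, norm_smul] at h
    rw [Real.norm_of_nonpos (by norm_num)] at h
    nlinarith
  unfold coulombGaussian
  have h3 : √(t ^ 3) * √(t ^ 3) = t ^ 3 := Real.mul_self_sqrt (by positivity)
  have : √(t ^ 3) * Real.exp (-t ^ 2 * ‖y - u‖ ^ 2) * (√(t ^ 3) * Real.exp (-t ^ 2 * ‖y' - u‖ ^ 2)) =
      (√(t ^ 3) * √(t ^ 3)) * Real.exp (-t ^ 2 * ‖y - u‖ ^ 2 + -t ^ 2 * ‖y' - u‖ ^ 2) := by
    rw [Real.exp_add]; ring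
  simp only [this, h3]
  rw [mul_assoc, ← Real.exp_add]
  congr 2
  linear_combination (-t ^ 2) * hpar

theorem integral_coulombGaussian_section {t : ℝ} (ht : 0 < t) (y y' : R3) :
    ∫ u, coulombGaussian (t, u) y * coulombGaussian (t, u) y' =
      (Real.pi / 2) ^ (3 / 2 : ℝ) * Real.exp (-(‖y - y'‖ ^ 2 / 2) * t ^ 2) := by
  simp only [coulombGaussian_mul ht]
  rw [integral_const_mul, integral_sub_right_eq_self (fun u : R3 => Real.exp (-(2 * t ^ 2) * ‖u‖ ^ 2)),
    GaussianFourier.integral_rexp_neg_mul_sq_norm (by positivity), finrank_euclideanSpace_fin]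
  have h : (Real.pi / (2 * t ^ 2)) ^ ((3 : ℕ) / 2 : ℝ) = (Real.pi / 2) ^ (3 / 2 : ℝ) / t ^ 3 := by
    have e : Real.pi / (2 * t ^ 2) = (Real.pi / 2) / t ^ 2 := by field_simp
    rw [e, Real.div_rpow (by positivity) (by positivity)]
    congr 1
    rw [← Real.rpow_natCast, ← Real.rpow_mul ht.le]
    norm_num
  rw [h]
  field_simp

theorem coulombGaussian_kernel {y y' : R3} (hne : y ≠ y') :
    Integrable (fun a => coulombGaussian a y * coulombGaussian a y')
      ((volume.restrict (Set.Ioi (0 : ℝ))).prod volume) ∧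
    ∫ a, coulombGaussian a y * coulombGaussian a y'
      ∂(volume.restrict (Set.Ioi (0 : ℝ))).prod volume =
      (Real.pi / 2) ^ (3 / 2 : ℝ) * (√(2 * Real.pi) / 2) * ‖y - y'‖⁻¹ := by
  have hd : 0 < ‖y - y'‖ := norm_pos_iff.2 (sub_ne_zero.2 hne)
  have hmeas : Measurable fun a => coulombGaussian a y * coulombGaussian a y' :=
    (measurable_coulombGaussian.comp (measurable_id.prodMk measurable_const)).mul
      (measurable_coulombGaussian.comp (measurable_id.prodMk measurable_const))
  have hint : Integrable (fun a => coulombGaussian a y * coulombGaussian a y')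
      ((volume.restrict (Set.Ioi (0 : ℝ))).prod volume) := by
    refine (integrable_prod_iff hmeas.aestronglyMeasurable).2 ⟨?_, ?_⟩
    · filter_upwards [ae_restrict_mem measurableSet_Ioi] with t ht
      refine Integrable.of_integral_ne_zero ?_
      rw [integral_coulombGaussian_section ht]
      positivity
    · have hg : Integrable (fun t : ℝ => (Real.pi / 2) ^ (3 / 2 : ℝ) *
          Real.exp (-(‖y - y'‖ ^ 2 / 2) * t ^ 2)) (volume.restrict (Set.Ioi (0 : ℝ))) :=
        ((integrable_exp_neg_mul_sq (by positivity)).const_mul _).integrableOn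
      refine hg.congr ?_
      filter_upwards [ae_restrict_mem measurableSet_Ioi] with t ht
      rw [← integral_coulombGaussian_section ht]
      refine integral_congr_ae (Filter.Eventually.of_forall fun u => ?_)
      simp only [Real.norm_eq_abs]
      exact (abs_of_nonneg
        (mul_nonneg (coulombGaussian_nonneg _ _) (coulombGaussian_nonneg _ _))).symm
  refine ⟨hint, ?_⟩
  rw [integral_prod _ hint, setIntegral_congr_fun measurableSet_Ioi
    (fun t ht => integral_coulombGaussian_section ht y y'), integral_const_mul,
    integral_gaussian_Ioi, mul_assoc]
  congr 1
  have e : Real.pi / (‖y - y'‖ ^ 2 / 2) = (2 * Real.pi) / ‖y - y'‖ ^ 2 := by field_simp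
  rw [e, Real.sqrt_div (by positivity), Real.sqrt_sq hd.le]
  field_simp

theorem ae_prod_ne : ∀ᵐ p : R3 × R3, p.1 ≠ p.2 := by
  have hm : MeasurableSet {p : R3 × R3 | p.1 ≠ p.2} :=
    (measurableSet_eq_fun measurable_fst measurable_snd).compl
  refine (Measure.ae_prod_iff_ae_ae hm).2 (Filter.Eventually.of_forall fun x => ?_)
  filter_upwards [Measure.ae_ne volume x] with y hy
  exact hy.symm

theorem integrable_inv_norm_sq_ball :
    Integrable ((Metric.ball (0 : R3) 1).indicator fun x => (‖x‖⁻¹) ^ 2) := by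
  rw [integrable_indicator_iff measurableSet_ball,
    integrableOn_fun_norm_addHaar volume (f := fun r => (r⁻¹) ^ 2), finrank_euclideanSpace_fin]
  refine (integrableOn_const (C := (1 : ℝ)) (by simp)).congr_fun (fun r hr => ?_)
    measurableSet_Ioo
  have : r ≠ 0 := hr.1.ne'
  simp only [smul_eq_mul]
  field_simp

theorem integrable_coulomb_energy {ρ : R3 → ℂ} (h1 : Integrable ρ)
    (h2 : Integrable fun y => ‖ρ y‖ ^ 2) :
    Integrable fun p : R3 × R3 => ‖ρ p.1‖ * ‖ρ p.2‖ * ‖p.1 - p.2‖⁻¹ := by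
  have b1 := h1.norm.mul_prod h1.norm
  have b2 := h2.mul_prod h1.norm
  have b3 := h1.norm.convolution_integrand (ContinuousLinearMap.mul ℝ ℝ) integrable_inv_norm_sq_ball
  refine ((b1.add b2).add b3).mono' ?_ (Filter.Eventually.of_forall fun p => ?_)
  · refine (b1.aestronglyMeasurable).mul ?_
    exact (by fun_prop : Measurable fun p : R3 × R3 => ‖p.1 - p.2‖⁻¹).aestronglyMeasurable
  · simp only [Pi.add_apply, ContinuousLinearMap.mul_apply']
    rw [Real.norm_of_nonneg (by positivity)]
    by_cases hp : p.1 - p.2 ∈ Metric.ball (0 : R3) 1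
    · rw [Set.indicator_of_mem hp]
      have : ‖ρ p.1‖ * ‖p.1 - p.2‖⁻¹ ≤ ‖ρ p.1‖ ^ 2 + ‖p.1 - p.2‖⁻¹ ^ 2 := by
        nlinarith [sq_nonneg (‖ρ p.1‖ - ‖p.1 - p.2‖⁻¹), sq_nonneg ‖ρ p.1‖,
          sq_nonneg ‖p.1 - p.2‖⁻¹]
      nlinarith [mul_le_mul_of_nonneg_left this (norm_nonneg (ρ p.2)),
        mul_nonneg (norm_nonneg (ρ p.1)) (norm_nonneg (ρ p.2))]
    · rw [Set.indicator_of_notMem hp]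
      have h : ‖p.1 - p.2‖⁻¹ ≤ 1 := by
        refine inv_le_one_of_one_le₀ ?_
        simpa using hp
      have := mul_le_mul_of_nonneg_left h (mul_nonneg (norm_nonneg (ρ p.1)) (norm_nonneg (ρ p.2)))
      have : 0 ≤ ‖ρ p.1‖ ^ 2 * ‖ρ p.2‖ := by positivity
      linarith

theorem coulomb_energy_nonneg {ρ : R3 → ℂ} (h1 : Integrable ρ)
    (h2 : Integrable fun y => ‖ρ y‖ ^ 2) :
    ∃ r : ℝ, 0 ≤ r ∧
      ∫ y, starRingEnd ℂ (∫ y', ((‖y - y'‖ : ℂ))⁻¹ * ρ y') * ρ y = (r : ℂ) := by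
  set C : ℝ := (Real.pi / 2) ^ (3 / 2 : ℝ) * (√(2 * Real.pi) / 2) with hC
  have hC0 : 0 < C := by positivity
  have hE := integrable_coulomb_energy h1 h2
  obtain ⟨I, hI0, key⟩ : ∃ I : ℝ, 0 ≤ I ∧
      ∫ p : R3 × R3, starRingEnd ℂ (ρ p.2) * ρ p.1 * ((C * ‖p.1 - p.2‖⁻¹ : ℝ) : ℂ)
        ∂volume.prod volume = (I : ℂ) := ⟨_, integral_nonneg fun a => sq_nonneg _, integral_conj_mul_kernel_eq ((volume.restrict (Set.Ioi (0 : ℝ))).prod volume)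
    (volume : Measure R3) measurable_coulombGaussian coulombGaussian_nonneg
    (k := fun p => C * ‖p.1 - p.2‖⁻¹)
    (by filter_upwards [ae_prod_ne] with p hp using coulombGaussian_kernel hp)
    h1.aestronglyMeasurable
    ((hE.const_mul C).congr (Filter.Eventually.of_forall fun p => by ring))⟩
  have hI : Integrable fun p : R3 × R3 =>
      starRingEnd ℂ (ρ p.2) * ρ p.1 * ((‖p.1 - p.2‖⁻¹ : ℝ) : ℂ) := by
    refine hE.mono ?_ (Filter.Eventually.of_forall fun p => ?_)
    · refine AEStronglyMeasurable.mul ((continuous_conj.comp_aestronglyMeasurable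
        h1.aestronglyMeasurable.comp_snd).mul h1.aestronglyMeasurable.comp_fst) ?_
      exact (by fun_prop : Measurable fun p : R3 × R3 =>
        ((‖p.1 - p.2‖⁻¹ : ℝ) : ℂ)).aestronglyMeasurable
    · simp [mul_comm]
  refine ⟨C⁻¹ * I, mul_nonneg (inv_nonneg.2 hC0.le) hI0, ?_⟩
  rw [Complex.ofReal_mul, ← key]
  have e1 : ∀ p : R3 × R3, starRingEnd ℂ (ρ p.2) * ρ p.1 * ((C * ‖p.1 - p.2‖⁻¹ : ℝ) : ℂ) =
      (C : ℂ) * (starRingEnd ℂ (ρ p.2) * ρ p.1 * ((‖p.1 - p.2‖⁻¹ : ℝ) : ℂ)) := by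
    intro p; push_cast; ring
  simp only [e1]
  rw [integral_const_mul, ← mul_assoc, Complex.ofReal_inv,
    inv_mul_cancel₀ (by exact_mod_cast hC0.ne'), one_mul]
  have e2 := integral_prod _ hI
  rw [← Measure.volume_eq_prod] at *
  rw [e2]
  refine integral_congr_ae (Filter.Eventually.of_forall fun y => ?_)
  simp only
  rw [← integral_conj, ← integral_mul_const]
  refine integral_congr_ae (Filter.Eventually.of_forall fun y' => ?_)
  simp only [map_mul, map_inv₀, Complex.conj_ofReal, Complex.ofReal_inv]
  ring

theorem hartree_nonneg [CompleteSpace 𝓗] {Smap : 𝓗 →L[ℂ] L1capL2} {Sadj : L2plusLinf →L[ℂ] 𝓗}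
    (hSadj : ∀ (g : Lsp 2 × Lsp ∞) (x : 𝓗),
      ⟪Sadj (Submodule.Quotient.mk g : L2plusLinf), x⟫_ℂ =
        ∫ y : R3, (starRingEnd ℂ) ((g.1 : R3 → ℂ) y + (g.2 : R3 → ℂ) y) *
          (((Smap x).1.1 : R3 → ℂ) y))
    {FH : L1capL2 →L[ℂ] L2plusLinf} (hFH : IsHartree FH) : 0 ≤ Sadj ∘L FH ∘L Smap := by
  rw [ContinuousLinearMap.nonneg_iff_isPositive, ContinuousLinearMap.isPositive_iff_complex]
  intro x
  obtain ⟨g, hg, hgF⟩ := hFH (Smap x)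
  have h1 : Integrable ((Smap x).1.1 : R3 → ℂ) := L1.integrable_coeFn _
  have h2 : Integrable fun y => ‖((Smap x).1.1 : R3 → ℂ) y‖ ^ 2 := by
    refine ((memLp_two_iff_integrable_sq_norm (Lp.aestronglyMeasurable _)).1
      (Lp.memLp (Smap x).1.2)).congr ?_
    filter_upwards [(Smap x).2] with y hy
    rw [hy]
  obtain ⟨r, hr0, hr⟩ := coulomb_energy_nonneg h1 h2
  have h : ⟪(Sadj ∘L FH ∘L Smap) x, x⟫_ℂ = (r : ℂ) := by
    rw [ContinuousLinearMap.comp_apply, ContinuousLinearMap.comp_apply, ← hg, hSadj, ← hr]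
    refine integral_congr_ae ?_
    filter_upwards [hgF] with y hy
    rw [hy]
  rw [h]
  simpa using hr0

/-! ### Spectral projections below the essential spectrum -/

namespace SpectralData

variable {P : SpectralData 𝓗}

theorem proj_eq_zero_iff {A : Set ℝ} (hA : MeasurableSet A) :
    P.proj A = 0 ↔ ∀ x, P.diag x A = 0 := by
  refine ⟨fun h x => by rw [P.diag_apply x A hA, h]; simp, fun h => ?_⟩
  ext x
  simpa [P.diag_apply x A hA] using h x

theorem proj_empty : P.proj ∅ = 0 :=
  (proj_eq_zero_iff MeasurableSet.empty).2 fun _ => measure_empty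

theorem proj_union_eq_zero {A B : Set ℝ} (hA : MeasurableSet A) (hB : MeasurableSet B)
    (h : P.proj A = 0) (h' : P.proj B = 0) : P.proj (A ∪ B) = 0 :=
  (proj_eq_zero_iff (hA.union hB)).2 fun x =>
    measure_union_null ((proj_eq_zero_iff hA).1 h x) ((proj_eq_zero_iff hB).1 h' x)

theorem proj_mono_eq_zero {A B : Set ℝ} (hA : MeasurableSet A) (hB : MeasurableSet B)
    (hAB : A ⊆ B) (h : P.proj B = 0) : P.proj A = 0 := by
  rw [← Set.inter_eq_left.2 hAB, ← P.proj_comp A B hA hB, h, ContinuousLinearMap.comp_zero]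

theorem proj_union_add_inter {A B : Set ℝ} (hA : MeasurableSet A) (hB : MeasurableSet B) :
    P.proj (A ∪ B) + P.proj (A ∩ B) = P.proj A + P.proj B := by
  have h := fun (C : Set ℝ) (hC : MeasurableSet C) => Represents.indicator P hC 1
  have hb := fun (C : Set ℝ) (hC : MeasurableSet C) => BddMeas.indicator_const hC 1
  have h1 := (h _ (hA.union hB)).add (hb _ (hA.union hB)) (hb _ (hA.inter hB)) (h _ (hA.inter hB))
  have h2 := (h _ hA).add (hb _ hA) (hb _ hB) (h _ hB)
  rw [Set.indicator_union_add_inter] at h1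
  simpa using h1.unique h2

theorem finiteRank_proj_mono {A B : Set ℝ} (hA : MeasurableSet A) (hB : MeasurableSet B)
    (hAB : A ⊆ B) (h : FiniteRankOp (P.proj B)) : FiniteRankOp (P.proj A) := by
  rw [← Set.inter_eq_left.2 hAB, ← P.proj_comp A B hA hB]
  exact h.comp_left _

theorem finiteRank_proj_union {A B : Set ℝ} (hA : MeasurableSet A) (hB : MeasurableSet B)
    (h : FiniteRankOp (P.proj A)) (h' : FiniteRankOp (P.proj B)) :
    FiniteRankOp (P.proj (A ∪ B)) := by
  have e : P.proj (A ∪ B) = P.proj A + P.proj B + (-1 : ℂ) • P.proj (A ∩ B) := by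
    rw [← proj_union_add_inter hA hB]; module
  rw [e]
  exact (h.add h').add
    ((finiteRank_proj_mono (hA.inter hB) hA Set.inter_subset_left h).smul _)

theorem bddBelow_essSpec {E₀ : ℝ} (h : P.proj (Set.Iio E₀) = 0) : BddBelow P.essSpec := by
  refine ⟨E₀, fun a ha => ?_⟩
  by_contra! hlt
  refine ha (E₀ - a) (by linarith) ?_
  have : P.proj (Set.Ioo (a - (E₀ - a)) (a + (E₀ - a))) = 0 :=
    proj_mono_eq_zero measurableSet_Ioo measurableSet_Iio (fun b hb => by
      have := hb.2; simp only [Set.mem_Iio]; linarith) h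
  rw [this]
  exact finiteRankOp_zero

/-- Below the essential spectrum the spectral projections have finite rank. -/
theorem finiteRank_proj_Iic {E₀ b : ℝ} (h : P.proj (Set.Iio E₀) = 0)
    (hb : b < sInf P.essSpec) : FiniteRankOp (P.proj (Set.Iic b)) := by
  obtain ⟨A, hA, hsub, hfin⟩ : ∃ A, MeasurableSet A ∧ Set.Icc E₀ b ⊆ A ∧
      FiniteRankOp (P.proj A) := by
    refine isCompact_Icc.induction_on (p := fun S => ∃ A, MeasurableSet A ∧ S ⊆ A ∧
      FiniteRankOp (P.proj A)) ⟨∅, MeasurableSet.empty, le_rfl, ?_⟩ ?_ ?_ ?_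
    · rw [proj_empty]; exact finiteRankOp_zero
    · rintro S T hST ⟨A, hA, hs, hf⟩
      exact ⟨A, hA, hST.trans hs, hf⟩
    · rintro S T ⟨A, hA, hs, hf⟩ ⟨B, hB, hs', hf'⟩
      exact ⟨A ∪ B, hA.union hB, Set.union_subset_union hs hs', finiteRank_proj_union hA hB hf hf'⟩
    · intro a ha
      have : a ∉ P.essSpec := fun hmem =>
        (csInf_le (bddBelow_essSpec h) hmem).not_gt (ha.2.trans_lt hb)
      simp only [essSpec, Set.mem_ofPred_eq, not_forall, not_not] at this
      obtain ⟨ε, hε, hf⟩ := this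
      exact ⟨_, mem_nhdsWithin_of_mem_nhds (Ioo_mem_nhds (by linarith) (by linarith)),
        _, measurableSet_Ioo, le_rfl, hf⟩
  refine finiteRank_proj_mono measurableSet_Iic (measurableSet_Iio.union hA) ?_
    (finiteRank_proj_union measurableSet_Iio hA (h ▸ finiteRankOp_zero) hfin)
  intro a ha
  rcases lt_or_ge a E₀ with h1 | h1
  · exact Or.inl h1
  · exact Or.inr (hsub ⟨h1, ha⟩)

/-- A ground state is separated from the rest of the spectrum by a gap. -/
theorem exists_gap {E₀ : ℝ} {Ψ₀ : 𝓗} (h : IsGroundState P E₀ Ψ₀) :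
    ∃ g > 0, P.proj (Set.Iio E₀ ∪ Set.Ioo E₀ (E₀ + g)) = 0 := by
  obtain ⟨ε, hε, hproj⟩ := h.isolated
  refine ⟨ε, hε, proj_union_eq_zero measurableSet_Iio measurableSet_Ioo h.bottom ?_⟩
  have hsub : Set.Ioo E₀ (E₀ + ε) ⊆ Set.Ioo (E₀ - ε) (E₀ + ε) :=
    Set.Ioo_subset_Ioo_left (by linarith)
  rw [← Set.inter_eq_left.2 hsub, ← P.proj_comp _ _ measurableSet_Ioo measurableSet_Ioo, hproj,
    P.proj_comp _ _ measurableSet_Ioo (measurableSet_singleton _)]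
  simp [proj_empty]

/-! ### The Laplace transform of the sine propagator -/

theorem integral_exp_mul_sin {z : ℂ} (hz : 0 < z.im) (a : ℝ) :
    ∫ t in Set.Ioi (0 : ℝ), Complex.exp (Complex.I * z * t) * ((Real.sin (t * a) : ℝ) : ℂ) =
      (a : ℂ) / (a ^ 2 - z ^ 2) := by
  have h1 : (Complex.I * (z + a)).re < 0 := by simp [hz]
  have h2 : (Complex.I * (z - a)).re < 0 := by simp [hz]
  have e : ∀ t : ℝ, Complex.exp (Complex.I * z * t) * ((Real.sin (t * a) : ℝ) : ℂ) =
      (Complex.I / 2) * Complex.exp (Complex.I * (z - a) * t) -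
        (Complex.I / 2) * Complex.exp (Complex.I * (z + a) * t) := by
    intro t
    rw [Complex.ofReal_sin, Complex.sin,
      show Complex.I * (z - a) * t = Complex.I * z * t + -(((t * a : ℝ) : ℂ)) * Complex.I by
        push_cast; ring,
      show Complex.I * (z + a) * t = Complex.I * z * t + ((t * a : ℝ) : ℂ) * Complex.I by
        push_cast; ring, Complex.exp_add, Complex.exp_add]
    ring
  simp only [e]
  rw [integral_sub ((integrableOn_exp_mul_complex_Ioi h2 0).const_mul _)
    ((integrableOn_exp_mul_complex_Ioi h1 0).const_mul _), integral_const_mul, integral_const_mul,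
    integral_exp_mul_complex_Ioi h1, integral_exp_mul_complex_Ioi h2]
  have n1 : z + a ≠ 0 := fun h => by simp [h] at h1
  have n2 : z - a ≠ 0 := fun h => by simp [h] at h2
  have n3 : (a : ℂ) ^ 2 - z ^ 2 ≠ 0 := by
    rw [show (a : ℂ) ^ 2 - z ^ 2 = -((z - a) * (z + a)) by ring]
    exact neg_ne_zero.2 (mul_ne_zero n2 n1)
  simp only [Complex.ofReal_zero, mul_zero, Complex.exp_zero]
  field_simp
  ring

theorem norm_div_sq_sub_sq_le {z : ℂ} (hz : 0 < z.im) (a : ℝ) :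
    ‖(a : ℂ) / (a ^ 2 - z ^ 2)‖ ≤ 1 / z.im := by
  have n1 : z.im ≤ ‖z + a‖ := by simpa using (le_abs_self _).trans (Complex.abs_im_le_norm (z + a))
  have n2 : z.im ≤ ‖z - a‖ := by simpa using (le_abs_self _).trans (Complex.abs_im_le_norm (z - a))
  have p1 : 0 < ‖z + a‖ := hz.trans_le n1
  have p2 : 0 < ‖z - a‖ := hz.trans_le n2
  rw [show (a : ℂ) ^ 2 - z ^ 2 = -((z - a) * (z + a)) by ring, norm_div, norm_neg, norm_mul,
    div_le_div_iff₀ (mul_pos p2 p1) hz, one_mul]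
  have h : 2 * ‖(a : ℂ)‖ ≤ ‖z + a‖ + ‖z - a‖ := by
    have := norm_sub_le (z + a) (z - a)
    rw [show z + a - (z - a) = 2 * (a : ℂ) by ring, norm_mul] at this
    simpa using this
  nlinarith [mul_nonneg (sub_nonneg.2 n1) p2.le, mul_nonneg (sub_nonneg.2 n2) p1.le]

variable [CompleteSpace 𝓗]

section Sine

variable {E₀ : ℝ} {sinOp : ℝ → (𝓗 →L[ℂ] 𝓗)}

theorem bddMeas_sin (t : ℝ) (E₀ : ℝ) :
    BddMeas fun lam => ((Real.sin (t * (E₀ - lam)) : ℝ) : ℂ) :=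
  ⟨by fun_prop, 1, fun a => by
    rw [Complex.norm_real]; exact Real.abs_sin_le_one _⟩

theorem norm_sinOp_le
    (hsin : ∀ t, P.Represents (fun lam => ((Real.sin (t * (E₀ - lam)) : ℝ) : ℂ)) (sinOp t))
    (t : ℝ) : ‖sinOp t‖ ≤ 1 :=
  (hsin t).norm_le (bddMeas_sin t E₀) fun a => by
    rw [Complex.norm_real]; exact Real.abs_sin_le_one _

theorem continuous_sinOp
    (hsin : ∀ t, P.Represents (fun lam => ((Real.sin (t * (E₀ - lam)) : ℝ) : ℂ)) (sinOp t))
    (x : 𝓗) : Continuous fun t => sinOp t x :=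
  Represents.continuous_apply (fun t => (bddMeas_sin t E₀).1) (c := 1) (fun t a => by
    rw [Complex.norm_real]; exact Real.abs_sin_le_one _) (fun a => by fun_prop) hsin x

theorem norm_exp_I_mul (z : ℂ) (t : ℝ) :
    ‖Complex.exp (Complex.I * z * t)‖ = Real.exp (-z.im * t) := by
  rw [Complex.norm_exp]; simp

theorem integrableOn_exp_smul_sinOp
    (hsin : ∀ t, P.Represents (fun lam => ((Real.sin (t * (E₀ - lam)) : ℝ) : ℂ)) (sinOp t))
    {z : ℂ} (hz : 0 < z.im) (x : 𝓗) :
    IntegrableOn (fun t : ℝ => Complex.exp (Complex.I * z * t) • sinOp t x) (Set.Ioi 0) := by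
  refine ((integrableOn_exp_mul_Ioi (neg_lt_zero.2 hz) 0).mul_const ‖x‖).mono' ?_ ?_
  · have := continuous_sinOp hsin x
    exact (by fun_prop : Continuous fun t : ℝ =>
      Complex.exp (Complex.I * z * t) • sinOp t x).aestronglyMeasurable
  · refine Filter.Eventually.of_forall fun t => ?_
    rw [norm_smul, norm_exp_I_mul]
    gcongr
    exact ((sinOp t).le_of_opNorm_le (norm_sinOp_le hsin t) x).trans_eq (one_mul _)

/-- The Laplace transform of `sin(t(E₀ - H))` is `(E₀ - H) / ((E₀ - H)² - z²)`. -/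
theorem integral_exp_smul_sinOp
    (hsin : ∀ t, P.Represents (fun lam => ((Real.sin (t * (E₀ - lam)) : ℝ) : ℂ)) (sinOp t))
    {z : ℂ} (hz : 0 < z.im) {R : 𝓗 →L[ℂ] 𝓗}
    (hR : P.Represents (fun lam => ((E₀ - lam : ℝ) : ℂ) / (((E₀ - lam : ℝ) : ℂ) ^ 2 - z ^ 2)) R)
    (x : 𝓗) :
    ∫ t in Set.Ioi (0 : ℝ), Complex.exp (Complex.I * z * t) • sinOp t x = R x := by
  have hi := fun x => integrableOn_exp_smul_sinOp hsin hz x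
  set J : 𝓗 →ₗ[ℂ] 𝓗 :=
    { toFun := fun x => ∫ t in Set.Ioi (0 : ℝ), Complex.exp (Complex.I * z * t) • sinOp t x
      map_add' := fun x y => by
        simp only [map_add, smul_add]
        exact integral_add (hi x) (hi y)
      map_smul' := fun c x => by
        simp only [map_smul, RingHom.id_apply]
        rw [← integral_smul]
        simp only [smul_comm c] } with hJ
  suffices h : J = (R : 𝓗 →ₗ[ℂ] 𝓗) from DFunLike.congr_fun h x
  rw [← ext_inner_map]
  intro y
  rw [← inner_conj_symm, ← inner_conj_symm (ContinuousLinearMap.toLinearMap R y)]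
  congr 1
  rw [ContinuousLinearMap.coe_coe, hR y]
  change ⟪y, ∫ t in Set.Ioi (0 : ℝ), Complex.exp (Complex.I * z * t) • sinOp t y⟫_ℂ = _
  rw [← integral_inner (hi y)]
  have e : ∀ t : ℝ, ⟪y, Complex.exp (Complex.I * z * t) • sinOp t y⟫_ℂ =
      ∫ lam, Complex.exp (Complex.I * z * t) * ((Real.sin (t * (E₀ - lam)) : ℝ) : ℂ) ∂P.diag y := by
    intro t
    rw [inner_smul_right, hsin t y, integral_const_mul]
  simp only [e]
  rw [integral_integral_swap]
  · refine integral_congr_ae (Filter.Eventually.of_forall fun lam => ?_)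
    exact integral_exp_mul_sin hz _
  · have h1 : Integrable (fun p : ℝ × ℝ => Real.exp (-z.im * p.1) * (1 : ℝ))
        ((volume.restrict (Set.Ioi 0)).prod (P.diag y)) :=
      Integrable.mul_prod (f := fun t => Real.exp (-z.im * t)) (g := fun _ => (1 : ℝ))
        (integrableOn_exp_mul_Ioi (neg_lt_zero.2 hz) 0) (integrable_const _)
    refine h1.mono' ?_ (Filter.Eventually.of_forall fun p => ?_)
    · exact (by unfold Function.uncurry; fun_prop : Measurable _).aestronglyMeasurable
    · simp only [Function.uncurry]
      rw [norm_mul, norm_exp_I_mul, Complex.norm_real]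
      gcongr
      exact Real.abs_sin_le_one _

end Sine

end SpectralData

/-! ### Factorization of the resolvent -/

namespace SpectralData

section Factorization

variable {P : SpectralData 𝓗} [CompleteSpace 𝓗]

/-- The function `1 / (λ - E₀)`, cut off at distance `g` above `E₀`. -/
def cutInv (E₀ g lam : ℝ) : ℝ := (Set.Ici (E₀ + g)).indicator (fun lam => (lam - E₀)⁻¹) lam

theorem cutInv_nonneg {E₀ g : ℝ} (hg : 0 < g) (lam : ℝ) : 0 ≤ cutInv E₀ g lam :=
  Set.indicator_nonneg (fun a ha => inv_nonneg.2 (by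
    have : E₀ + g ≤ a := ha
    linarith)) lam

theorem measurable_cutInv (E₀ g : ℝ) : Measurable (cutInv E₀ g) :=
  (by fun_prop : Measurable fun lam : ℝ => (lam - E₀)⁻¹).indicator measurableSet_Ici

theorem cutInv_le {E₀ g b : ℝ} (hb : E₀ < b) {lam : ℝ} (hlam : b ≤ lam) :
    cutInv E₀ g lam ≤ (b - E₀)⁻¹ := by
  unfold cutInv
  refine Set.indicator_apply_le' (fun _ => ?_) (fun _ => inv_nonneg.2 (by linarith))
  exact inv_anti₀ (by linarith) (by linarith)

theorem cutInv_le_inv {E₀ g : ℝ} (hg : 0 < g) (lam : ℝ) : cutInv E₀ g lam ≤ g⁻¹ := by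
  unfold cutInv
  refine Set.indicator_apply_le' (fun h => ?_) (fun _ => inv_nonneg.2 hg.le)
  have : E₀ + g ≤ lam := h
  exact inv_anti₀ hg (by linarith)

theorem bddMeas_ofReal {f : ℝ → ℝ} (hf : Measurable f) {c : ℝ} (h0 : ∀ a, 0 ≤ f a)
    (hc : ∀ a, f a ≤ c) : BddMeas fun a => (f a : ℂ) :=
  ⟨Complex.measurable_ofReal.comp hf, c, fun a => by
    rw [Complex.norm_real, Real.norm_of_nonneg (h0 a)]; exact hc a⟩

/-- The square root of `1 / (H - E₀)` on the complement of the ground state. -/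
theorem exists_sqrt_cutInv (P : SpectralData 𝓗) {E₀ g : ℝ} (hg : 0 < g) :
    ∃ L : 𝓗 →L[ℂ] 𝓗, IsSelfAdjoint L ∧ P.Represents (fun a => (cutInv E₀ g a : ℂ)) (L * L) := by
  have hb : BddMeas fun a => (√(cutInv E₀ g a) : ℂ) :=
    bddMeas_ofReal (measurable_cutInv E₀ g).sqrt (fun a => Real.sqrt_nonneg _)
      (fun a => Real.sqrt_le_sqrt (cutInv_le_inv hg a))
  obtain ⟨L, hL⟩ := Represents.exists_of_bddMeas P hb
  refine ⟨L, hL.isSelfAdjoint, ?_⟩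
  have := hL.mul hb hb hL
  change P.Represents _ (L ∘L L)
  convert this using 1
  ext a
  rw [Pi.mul_apply, ← Complex.ofReal_mul, Real.mul_self_sqrt (cutInv_nonneg hg a)]

theorem bddMeas_cutInv {E₀ g : ℝ} (hg : 0 < g) : BddMeas fun a => (cutInv E₀ g a : ℂ) :=
  bddMeas_ofReal (measurable_cutInv E₀ g) (cutInv_nonneg hg) (cutInv_le_inv hg)

theorem nonneg_of_isSelfAdjoint_mul_self {Q : 𝓗 →L[ℂ] 𝓗} (hQ : IsSelfAdjoint Q) : 0 ≤ Q * Q := by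
  have := star_mul_self_nonneg Q
  rwa [hQ.star_eq] at this

/-- Below the essential spectrum, the square of `1 / (H - E₀)` is a finite-rank operator plus an
operator of small norm. -/
theorem exists_finiteRank_add {E₀ g Ω r : ℝ} (hg : 0 < g) (h : P.proj (Set.Iio E₀) = 0)
    (hΩ : Ω = sInf P.essSpec - E₀) (hΩ0 : 0 < Ω) (hr0 : 0 < r) (hr : r < Ω ^ 2) {Q : 𝓗 →L[ℂ] 𝓗}
    (hQ : P.Represents (fun a => (cutInv E₀ g a : ℂ)) Q) :
    ∃ R F, Q * Q = R + F ∧ FiniteRankOp F ∧ r * ‖R‖ < 1 := by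
  obtain ⟨s, hs1, hs2⟩ := exists_between ((Real.sqrt_lt' hΩ0).2 hr)
  have hs0 : 0 < s := (Real.sqrt_nonneg r).trans_lt hs1
  have hrs : r < s ^ 2 := (Real.sqrt_lt' hs0).1 hs1
  have hu : P.proj (Set.Iic (E₀ + s)) + P.proj (Set.Ioi (E₀ + s)) = 1 := by
    rw [← proj_union_add_inter measurableSet_Iic measurableSet_Ioi, Set.Iic_union_Ioi, P.proj_univ]
    have : Set.Iic (E₀ + s) ∩ Set.Ioi (E₀ + s) = ∅ := by
      ext a; simp
    rw [this, proj_empty, add_zero]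
    rfl
  refine ⟨Q * Q * P.proj (Set.Ioi (E₀ + s)), Q * Q * P.proj (Set.Iic (E₀ + s)), ?_, ?_, ?_⟩
  · rw [← mul_add, add_comm, hu, mul_one]
  · exact (finiteRank_proj_Iic h (by linarith)).comp_left (Q * Q)
  · have hb := bddMeas_cutInv (E₀ := E₀) hg
    have hR := (hQ.mul hb hb hQ).mul (hb.mul hb)
      (BddMeas.indicator_const (A := Set.Ioi (E₀ + s)) measurableSet_Ioi 1)
      (Represents.indicator P measurableSet_Ioi 1)
    rw [one_smul] at hR
    have hn := hR.norm_le ((hb.mul hb).mul (BddMeas.indicator_const measurableSet_Ioi 1))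
      (c := s⁻¹ ^ 2) (fun a => by
        by_cases ha : a ∈ Set.Ioi (E₀ + s)
        · have h1 : cutInv E₀ g a ≤ s⁻¹ := by
            have := cutInv_le (g := g) (by linarith : E₀ < E₀ + s) (le_of_lt ha)
            simpa using this
          have h0 := cutInv_nonneg (E₀ := E₀) hg a
          simp only [Pi.mul_apply, Set.indicator_of_mem ha, mul_one, norm_mul, Complex.norm_real,
            Real.norm_of_nonneg h0]
          nlinarith
        · simp only [Pi.mul_apply, Set.indicator_of_notMem ha, mul_zero, norm_zero]
          positivity)
    have hn' : ‖Q * Q * P.proj (Set.Ioi (E₀ + s))‖ ≤ s⁻¹ ^ 2 := hn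
    calc r * _ ≤ r * s⁻¹ ^ 2 := by gcongr
      _ < s ^ 2 * s⁻¹ ^ 2 := by gcongr
      _ = 1 := by field_simp

theorem bddMeas_resolvent {z : ℂ} (hz : 0 < z.im) (E₀ : ℝ) :
    BddMeas fun lam => ((E₀ - lam : ℝ) : ℂ) / (((E₀ - lam : ℝ) : ℂ) ^ 2 - z ^ 2) :=
  ⟨by fun_prop, 1 / z.im, fun a => norm_div_sq_sub_sq_le hz (E₀ - a)⟩

/-- `(E₀ - H) / ((E₀ - H)² - z²) = L (z² L⁴ - 1)⁻¹ L`. -/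
theorem represents_resolvent {E₀ g : ℝ} (hg : 0 < g)
    (hgap : P.proj (Set.Iio E₀ ∪ Set.Ioo E₀ (E₀ + g)) = 0) {L : 𝓗 →L[ℂ] 𝓗}
    (hQ : P.Represents (fun a => (cutInv E₀ g a : ℂ)) (L * L))
    {z : ℂ} (hz : 0 < z.im) (hu : IsUnit (z ^ 2 • (L * L * (L * L)) - 1)) :
    P.Represents (fun lam => ((E₀ - lam : ℝ) : ℂ) / (((E₀ - lam : ℝ) : ℂ) ^ 2 - z ^ 2))
      (L * Ring.inverse (z ^ 2 • (L * L * (L * L)) - 1) * L) := by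
  obtain ⟨R, hR⟩ := Represents.exists_of_bddMeas P (bddMeas_resolvent hz E₀)
  set A := z ^ 2 • (L * L * (L * L)) - 1 with hA
  have hq := bddMeas_cutInv (E₀ := E₀) hg
  have h1 : P.Represents (fun _ => (1 : ℂ)) (1 : 𝓗 →L[ℂ] 𝓗) := by
    have := Represents.indicator P MeasurableSet.univ 1
    rw [P.proj_univ, one_smul, Set.indicator_univ] at this
    exact this
  have hb1 : BddMeas fun _ => (1 : ℂ) := ⟨measurable_const, 1, fun a => by simp⟩
  have hbz : BddMeas fun a => z ^ 2 * ((fun a => (cutInv E₀ g a : ℂ)) * fun a => (cutInv E₀ g a : ℂ)) a := by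
    have : BddMeas fun _ => z ^ 2 := ⟨measurable_const, ‖z ^ 2‖, fun a => le_rfl⟩
    exact this.mul (hq.mul hq)
  have hArep : P.Represents _ A := ((hQ.mul hq hq hQ).smul (z ^ 2)).sub hbz hb1 h1
  have hRA : R * A = L * L := by
    refine ((hR.mul (bddMeas_resolvent hz E₀) (hbz.sub hb1) hArep).congr
      (measurableSet_Iio.union measurableSet_Ioo) hgap (fun a ha => ?_)).unique hQ
    simp only [Pi.mul_apply, Pi.sub_apply]
    have hne : ((E₀ - a : ℝ) : ℂ) ^ 2 - z ^ 2 ≠ 0 := by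
      intro h0
      have h2 : (((E₀ - a : ℝ) : ℂ) - z) * (((E₀ - a : ℝ) : ℂ) + z) = 0 := by
        rw [← h0]; ring
      rcases mul_eq_zero.1 h2 with h | h
      · have := congrArg Complex.im h; simp at this; linarith
      · have := congrArg Complex.im h; simp at this; linarith
    rcases lt_trichotomy a E₀ with h | h | h
    · exact absurd (Or.inl h) ha
    · subst h
      simp [cutInv, hg]
    · have hga : a ∈ Set.Ici (E₀ + g) := by
        by_contra hc
        exact ha (Or.inr ⟨h, not_le.1 hc⟩)
      have hna : ((E₀ - a : ℝ) : ℂ) ≠ 0 := by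
        exact_mod_cast (sub_neg.2 h).ne
      have e : (cutInv E₀ g a : ℂ) = -(((E₀ - a : ℝ) : ℂ))⁻¹ := by
        rw [cutInv, Set.indicator_of_mem hga, ← Complex.ofReal_inv, ← Complex.ofReal_neg]
        congr 1
        rw [← inv_neg]
        congr 1
        ring
      rw [e]
      field_simp
      ring
  have hcomm : Commute L A := by
    refine Commute.sub_right (Commute.smul_right ?_ _) (Commute.one_right L)
    have h : Commute L L := Commute.refl L
    exact (h.mul_right h).mul_right (h.mul_right h)
  have hcomm' : Commute L (Ring.inverse A) := by
    rw [Ring.inverse_of_isUnit hu]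
    exact Commute.units_inv_right (u := hu.unit) hcomm
  have : L * Ring.inverse A * L = R := by
    rw [hcomm'.eq, mul_assoc, ← (hcomm'.mul_left hcomm').eq, ← hRA, mul_assoc,
      Ring.mul_inverse_cancel _ hu, mul_one]
  rw [this]
  exact hR

end Factorization

end SpectralData

/-! ### Volterra equations and their Laplace transforms -/

section Volterra

theorem continuous_apply_of_norm_le {X : Type*} [TopologicalSpace X] {A : ℝ → 𝓗 →L[ℂ] 𝓗}
    (hA : ∀ t, ‖A t‖ ≤ 1) (hAc : ∀ x, Continuous fun t => A t x) {τ : X → ℝ} {h : X → 𝓗}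
    (hτ : Continuous τ) (hh : Continuous h) : Continuous fun p => A (τ p) (h p) := by
  rw [continuous_iff_continuousAt]
  intro p₀
  have h1 : Filter.Tendsto (fun p => A (τ p) (h p - h p₀)) (nhds p₀) (nhds 0) := by
    refine squeeze_zero_norm (a := fun p => ‖h p - h p₀‖) (fun p => ?_) ?_
    · exact ((A (τ p)).le_of_opNorm_le (hA _) _).trans_eq (one_mul _)
    · have : Continuous fun p => ‖h p - h p₀‖ := by fun_prop
      simpa using this.tendsto p₀
  have h2 : Filter.Tendsto (fun p => A (τ p) (h p₀)) (nhds p₀) (nhds (A (τ p₀) (h p₀))) :=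
    ((hAc (h p₀)).comp hτ).tendsto p₀
  have := h1.add h2
  simp only [← map_add, sub_add_cancel, zero_add] at this
  exact this

/-- The inner product with its arguments swapped, as a real bilinear map. -/
def innerFlip (𝓗 : Type*) [NormedAddCommGroup 𝓗] [InnerProductSpace ℂ 𝓗] : 𝓗 →L[ℝ] 𝓗 →L[ℝ] ℂ :=
  LinearMap.mkContinuous₂ (LinearMap.mk₂ ℝ (fun a b : 𝓗 => ⟪b, a⟫_ℂ)
    (fun a b c => inner_add_right _ _ _)
    (fun r a b => by
      rw [← Complex.coe_smul, inner_smul_right]; simp)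
    (fun a b c => inner_add_left _ _ _)
    (fun r a b => by
      rw [← Complex.coe_smul, inner_smul_left]; simp)) 1
    (fun a b => by
      rw [one_mul, mul_comm]; exact norm_inner_le_norm b a)

theorem innerFlip_apply (a b : 𝓗) : innerFlip 𝓗 a b = ⟪b, a⟫_ℂ := rfl

variable {A : ℝ → 𝓗 →L[ℂ] 𝓗} {T : 𝓗 →L[ℂ] 𝓗} {x₀ : 𝓗} {h u : ℝ → 𝓗}

theorem continuous_volterra_integrand (hA : ∀ t, ‖A t‖ ≤ 1) (hAc : ∀ x, Continuous fun t => A t x)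
    (hh : Continuous h) : Continuous (Function.uncurry fun t s => A (t - s) (h s)) :=
  continuous_apply_of_norm_le hA hAc (by fun_prop : Continuous fun p : ℝ × ℝ => p.1 - p.2)
    (by fun_prop : Continuous fun p : ℝ × ℝ => h p.2)

theorem continuous_volterra [CompleteSpace 𝓗] (hA : ∀ t, ‖A t‖ ≤ 1) (hAc : ∀ x, Continuous fun t => A t x)
    (hh : Continuous h)
    (hu : ∀ t, u t = (2 : ℂ) • A t x₀ + (2 : ℂ) • ∫ s in (0 : ℝ)..t, A (t - s) (h s)) :
    Continuous u := by
  have h1 := intervalIntegral.continuous_parametric_intervalIntegral_of_continuous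
    (continuous_volterra_integrand hA hAc hh) (s := fun t : ℝ => t) (a₀ := 0) (μ := volume)
    continuous_id
  rw [funext hu]
  exact ((hAc x₀).const_smul _).add (h1.const_smul _)

theorem norm_volterra_le (hA : ∀ t, ‖A t‖ ≤ 1)
    (hh : Continuous h)
    (hu : ∀ t, u t = (2 : ℂ) • A t x₀ + (2 : ℂ) • ∫ s in (0 : ℝ)..t, A (t - s) (h s))
    (hT : ∀ t, 0 ≤ t → T (u t) = h t) {t : ℝ} (ht : 0 ≤ t) :
    ‖u t‖ ≤ 2 * (‖x₀‖ * Real.exp (2 * ‖T‖ * t)) := by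
  set φ : ℝ → ℝ := fun t => ‖x₀‖ + ∫ s in (0 : ℝ)..t, ‖h s‖ with hφ
  have hAx : ∀ t x, ‖A t x‖ ≤ ‖x‖ := fun t x =>
    ((A t).le_of_opNorm_le (hA t) x).trans_eq (one_mul _)
  have hφ0 : ∀ t, 0 ≤ t → 0 ≤ φ t := fun t ht =>
    add_nonneg (norm_nonneg _) (intervalIntegral.integral_nonneg ht fun s _ => norm_nonneg _)
  have hle : ∀ t, 0 ≤ t → ‖u t‖ ≤ 2 * φ t := by
    intro t ht
    have h1 : ‖∫ s in (0 : ℝ)..t, A (t - s) (h s)‖ ≤ ∫ s in (0 : ℝ)..t, ‖h s‖ :=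
      intervalIntegral.norm_integral_le_of_norm_le ht
        (Filter.Eventually.of_forall fun s _ => hAx _ _) (hh.norm.intervalIntegrable _ _)
    calc ‖u t‖ ≤ ‖(2 : ℂ) • A t x₀‖ + ‖(2 : ℂ) • ∫ s in (0 : ℝ)..t, A (t - s) (h s)‖ := by
          rw [hu t]; exact norm_add_le _ _
      _ ≤ 2 * ‖x₀‖ + 2 * ∫ s in (0 : ℝ)..t, ‖h s‖ := by
          rw [norm_smul, norm_smul]
          have : ‖(2 : ℂ)‖ = 2 := by simp
          rw [this]
          gcongr
          exact hAx _ _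
      _ = 2 * φ t := by simp only [hφ]; ring
  have hder : ∀ t, HasDerivAt φ ‖h t‖ t := fun t =>
    (intervalIntegral.integral_hasDerivAt_right (hh.norm.intervalIntegrable _ _)
      hh.norm.stronglyMeasurable.stronglyMeasurableAtFilter hh.norm.continuousAt).const_add _
  have hgr := norm_le_gronwallBound_of_norm_deriv_right_le (f := φ) (f' := fun t => ‖h t‖)
    (δ := ‖x₀‖) (K := 2 * ‖T‖) (ε := 0) (a := 0) (b := t)
    (fun s _ => (hder s).continuousAt.continuousWithinAt)
    (fun s _ => (hder s).hasDerivWithinAt) (by simp [hφ])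
    (fun s hs => by
      rw [norm_norm, ← hT s hs.1, Real.norm_of_nonneg (hφ0 s hs.1), add_zero]
      calc ‖T (u s)‖ ≤ ‖T‖ * ‖u s‖ := T.le_opNorm _
        _ ≤ ‖T‖ * (2 * φ s) := by gcongr; exact hle s hs.1
        _ = _ := by ring) t ⟨ht, le_rfl⟩
  rw [gronwallBound_ε0, sub_zero, Real.norm_of_nonneg (hφ0 t ht)] at hgr
  exact (hle t ht).trans (by gcongr)

theorem integrableOn_exp_smul {z : ℂ} {c D : ℝ} (hz : D < z.im) {v : ℝ → 𝓗} (hv : Continuous v)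
    (hb : ∀ t, 0 ≤ t → ‖v t‖ ≤ c * Real.exp (D * t)) :
    IntegrableOn (fun t : ℝ => Complex.exp (Complex.I * z * t) • v t) (Set.Ioi 0) := by
  have : D - z.im < 0 := by linarith
  refine ((integrableOn_exp_mul_Ioi this 0).const_mul c).mono' ?_ ?_
  · exact (by fun_prop : Continuous fun t : ℝ =>
      Complex.exp (Complex.I * z * t) • v t).aestronglyMeasurable
  · filter_upwards [ae_restrict_mem measurableSet_Ioi] with t ht
    rw [norm_smul, SpectralData.norm_exp_I_mul]
    calc _ ≤ Real.exp (-z.im * t) * (c * Real.exp (D * t)) := by gcongr; exact hb t (le_of_lt ht)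
      _ = c * Real.exp ((D - z.im) * t) := by
        rw [mul_left_comm, ← Real.exp_add]; ring_nf

theorem integrableOn_exp_smul_volterra [CompleteSpace 𝓗] (hA : ∀ t, ‖A t‖ ≤ 1)
    (hAc : ∀ x, Continuous fun t => A t x) (hh : Continuous h)
    (hu : ∀ t, u t = (2 : ℂ) • A t x₀ + (2 : ℂ) • ∫ s in (0 : ℝ)..t, A (t - s) (h s))
    (hT : ∀ t, 0 ≤ t → T (u t) = h t) {z : ℂ} (hz : 2 * ‖T‖ < z.im) :
    IntegrableOn (fun t : ℝ => Complex.exp (Complex.I * z * t) • u t) (Set.Ioi 0) :=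
  integrableOn_exp_smul (c := 2 * ‖x₀‖) hz (continuous_volterra hA hAc hh hu) fun t ht => by
    rw [mul_assoc]; exact norm_volterra_le hA hh hu hT ht

/-- The Laplace transform turns the Volterra equation into an algebraic one. -/
theorem laplace_volterra [CompleteSpace 𝓗] (hA : ∀ t, ‖A t‖ ≤ 1) (hAsa : ∀ t, IsSelfAdjoint (A t))
    (hAc : ∀ x, Continuous fun t => A t x) (hh : Continuous h)
    (hu : ∀ t, u t = (2 : ℂ) • A t x₀ + (2 : ℂ) • ∫ s in (0 : ℝ)..t, A (t - s) (h s))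
    (hT : ∀ t, 0 ≤ t → T (u t) = h t) {z : ℂ} (hz : 2 * ‖T‖ < z.im) {R : 𝓗 →L[ℂ] 𝓗}
    (hR : ∀ x, ∫ t in Set.Ioi (0 : ℝ), Complex.exp (Complex.I * z * t) • A t x = R x) :
    ∫ t in Set.Ioi (0 : ℝ), Complex.exp (Complex.I * z * t) • u t =
      (2 : ℂ) • R (x₀ + T (∫ t in Set.Ioi (0 : ℝ), Complex.exp (Complex.I * z * t) • u t)) := by
  have hz0 : 0 < z.im := (by positivity : (0 : ℝ) ≤ 2 * ‖T‖).trans_lt hz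
  have hui := integrableOn_exp_smul_volterra hA hAc hh hu hT hz
  set U := ∫ t in Set.Ioi (0 : ℝ), Complex.exp (Complex.I * z * t) • u t with hU
  have hAi : ∀ x, IntegrableOn (fun t : ℝ => Complex.exp (Complex.I * z * t) • A t x)
      (Set.Ioi 0) := fun x => integrableOn_exp_smul (c := ‖x‖) hz0 (hAc x) fun t _ => by
    simpa using (A t).le_of_opNorm_le (hA t) x
  have hTe : ∀ t ∈ Set.Ioi (0 : ℝ), T (Complex.exp (Complex.I * z * t) • u t) =
      Complex.exp (Complex.I * z * t) • h t := fun t ht => by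
    rw [map_smul, hT t (le_of_lt ht)]
  have hhi : IntegrableOn (fun t : ℝ => Complex.exp (Complex.I * z * t) • h t) (Set.Ioi 0) :=
    (T.integrable_comp hui).congr (by
      filter_upwards [ae_restrict_mem measurableSet_Ioi] with t ht using hTe t ht)
  have hhU : ∫ t in Set.Ioi (0 : ℝ), Complex.exp (Complex.I * z * t) • h t = T U := by
    rw [hU, ← ContinuousLinearMap.integral_comp_comm T hui]
    exact (setIntegral_congr_fun measurableSet_Ioi hTe).symm
  have hself : ∀ t x y, ⟪A t x, y⟫_ℂ = ⟪x, A t y⟫_ℂ := fun t =>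
    ContinuousLinearMap.isSelfAdjoint_iff_isSymmetric.1 (hAsa t)
  have hgi : ∀ y, IntegrableOn
      (fun t : ℝ => starRingEnd ℂ (Complex.exp (Complex.I * z * t)) • A t y) (Set.Ioi 0) := by
    intro y
    refine MeasureTheory.Integrable.mono (hAi y) ?_ (Filter.Eventually.of_forall fun t => ?_)
    · have := hAc y
      exact ((continuous_conj.comp (by fun_prop : Continuous fun t : ℝ =>
        Complex.exp (Complex.I * z * t))).smul this).aestronglyMeasurable
    · rw [norm_smul, norm_smul, RCLike.norm_conj]
  have hconv : ∀ y, ∫ t in Set.Ioi (0 : ℝ), ∫ s in (0 : ℝ)..t,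
      innerFlip 𝓗 (Complex.exp (Complex.I * z * s) • h s)
        (starRingEnd ℂ (Complex.exp (Complex.I * z * ((t - s : ℝ) : ℂ))) • A (t - s) y) =
      ⟪y, R (T U)⟫_ℂ := by
    intro y
    rw [integral_posConvolution hhi (hgi y) (innerFlip 𝓗), innerFlip_apply, hhU, ← hR (T U),
      ← integral_inner (hAi (T U)), ← inner_conj_symm, ← integral_inner (hgi y), ← integral_conj]
    refine integral_congr_ae (Filter.Eventually.of_forall fun t => ?_)
    simp only
    rw [inner_conj_symm, inner_smul_left, inner_smul_right, hself, RingHomCompTriple.comp_apply,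
      RingHom.id_apply]
  have hin : ∀ y (t : ℝ), ∫ s in (0 : ℝ)..t,
      innerFlip 𝓗 (Complex.exp (Complex.I * z * s) • h s)
        (starRingEnd ℂ (Complex.exp (Complex.I * z * ((t - s : ℝ) : ℂ))) • A (t - s) y) =
      ⟪y, Complex.exp (Complex.I * z * t) • ∫ s in (0 : ℝ)..t, A (t - s) (h s)⟫_ℂ := by
    intro y t
    have hc : Continuous fun s => A (t - s) (h s) :=
      (continuous_volterra_integrand hA hAc hh).comp (by fun_prop : Continuous fun s : ℝ => (t, s))
    rw [inner_smul_right, ← innerSL_apply_apply ℂ y,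
      ← ContinuousLinearMap.intervalIntegral_comp_comm _ (hc.intervalIntegrable _ _),
      ← intervalIntegral.integral_const_mul]
    refine intervalIntegral.integral_congr fun s _ => ?_
    rw [innerFlip_apply, inner_smul_left, inner_smul_right, hself, innerSL_apply_apply,
      RingHomCompTriple.comp_apply, RingHom.id_apply, ← mul_assoc, ← Complex.exp_add]
    congr 2
    push_cast
    ring
  refine ext_inner_left ℂ fun y => ?_
  have hsum : ∀ t : ℝ, Complex.exp (Complex.I * z * t) • u t =
      (2 : ℂ) • (Complex.exp (Complex.I * z * t) • A t x₀) +
      (2 : ℂ) • (Complex.exp (Complex.I * z * t) • ∫ s in (0 : ℝ)..t, A (t - s) (h s)) := by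
    intro t
    rw [hu t, smul_add, smul_comm _ (2 : ℂ), smul_comm _ (2 : ℂ)]
  have hVi : IntegrableOn (fun t : ℝ => (2 : ℂ) •
      (Complex.exp (Complex.I * z * t) • ∫ s in (0 : ℝ)..t, A (t - s) (h s))) (Set.Ioi 0) := by
    refine (hui.sub ((hAi x₀).smul (2 : ℂ))).congr (Filter.Eventually.of_forall fun t => ?_)
    simp only [Pi.sub_apply, Pi.smul_apply, hsum t, add_sub_cancel_left]
  have hUsum : U = (2 : ℂ) • R x₀ + ∫ t in Set.Ioi (0 : ℝ), (2 : ℂ) •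
      (Complex.exp (Complex.I * z * t) • ∫ s in (0 : ℝ)..t, A (t - s) (h s)) := by
    rw [hU]
    simp only [hsum]
    have hAx : IntegrableOn (fun t : ℝ => (2 : ℂ) • (Complex.exp (Complex.I * z * t) • A t x₀))
      (Set.Ioi 0) := (hAi x₀).smul (2 : ℂ)
    rw [integral_add hAx hVi, integral_smul, hR]
  rw [hUsum, inner_add_right, ← integral_inner hVi, map_add, smul_add, inner_add_right]
  congr 1
  rw [inner_smul_right, ← hUsum, ← hconv y, ← integral_const_mul]
  refine integral_congr_ae (Filter.Eventually.of_forall fun t => ?_)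
  simp only
  rw [hin, inner_smul_right]

end Volterra

/-! ### The Dyson equation in frequency space -/

theorem one_le_one_add_conjugate [CompleteSpace 𝓗] {L T : 𝓗 →L[ℂ] 𝓗} (hL : IsSelfAdjoint L)
    (hT : 0 ≤ T) : 1 ≤ 1 + (2 : ℂ) • (L * T * L) := by
  have h := hL.conjugate_nonneg hT
  have : (2 : ℂ) • (L * T * L) = L * T * L + L * T * L := two_smul _ _
  rw [this]
  exact le_add_of_nonneg_right (add_nonneg h h)

theorem eq_pencil_inverse_of_eq_resolvent {L Q T : 𝓗 →L[ℂ] 𝓗} {x₀ U : 𝓗} {ζ : ℂ}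
    (h1 : IsUnit (ζ • Q - 1)) (h2 : IsUnit (ζ • Q - (1 + (2 : ℂ) • (L * T * L))))
    (hU : U = (2 : ℂ) • (L * Ring.inverse (ζ • Q - 1) * L) (x₀ + T U)) :
    U = (2 : ℂ) • (L * Ring.inverse (ζ • Q - (1 + (2 : ℂ) • (L * T * L))) * L) x₀ := by
  set e := (2 : ℂ) • Ring.inverse (ζ • Q - 1) (L (x₀ + T U)) with he
  have hUe : U = L e := by rw [hU]; simp [he]
  have e1 : (ζ • Q - 1) e = (2 : ℂ) • L (x₀ + T U) := by
    rw [he, map_smul, ← mul_apply_eq_comp, Ring.mul_inverse_cancel _ h1]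
    rfl
  have e2 : (ζ • Q - (1 + (2 : ℂ) • (L * T * L))) e = (2 : ℂ) • L x₀ := by
    have : (ζ • Q - (1 + (2 : ℂ) • (L * T * L))) e = (ζ • Q - 1) e - (2 : ℂ) • L (T (L e)) := by
      simp [sub_sub]
    rw [this, e1, ← hUe, map_add, smul_add, add_sub_cancel_right]
  have e3 : e = Ring.inverse (ζ • Q - (1 + (2 : ℂ) • (L * T * L))) ((2 : ℂ) • L x₀) := by
    rw [← e2, ← mul_apply_eq_comp, Ring.inverse_mul_cancel _ h2]
    rfl
  rw [hUe, e3]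
  simp

theorem sq_im_ne_zero_or_re_nonpos {z : ℂ} (hz : z.im ≠ 0 ∨ z = 0) :
    (z ^ 2).im ≠ 0 ∨ (z ^ 2).re ≤ 0 := by
  rcases hz with hz | rfl
  · rw [pow_two, Complex.mul_im, Complex.mul_re]
    by_cases h : z.re = 0
    · right
      rw [h]
      nlinarith [mul_self_nonneg z.im]
    · left
      have := mul_ne_zero h hz
      intro h'
      apply this
      linarith [mul_comm z.im z.re]
  · simp

/-- The Fourier transform of a solution of the Dyson equation. -/
theorem isFourierTransformOf_dyson [CompleteSpace 𝓗] {P : SpectralData 𝓗} {E₀ g : ℝ}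
    (hg : 0 < g) (hgap : P.proj (Set.Iio E₀ ∪ Set.Ioo E₀ (E₀ + g)) = 0)
    {Smap : 𝓗 →L[ℂ] L1capL2} {Sadj : L2plusLinf →L[ℂ] 𝓗} {sinOp : ℝ → (𝓗 →L[ℂ] 𝓗)}
    (hsin : ∀ t, P.Represents (fun lam => ((Real.sin (t * (E₀ - lam)) : ℝ) : ℂ)) (sinOp t))
    {χ₀ : ℝ≥0 → (L2plusLinf →L[ℂ] L1capL2)}
    (hχ₀ : ∀ t : ℝ≥0, χ₀ t = (2 : ℂ) • (Smap ∘L sinOp (t : ℝ) ∘L Sadj))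
    {FH : L1capL2 →L[ℂ] L2plusLinf} {χ : ℝ≥0 → (L2plusLinf →L[ℂ] L1capL2)}
    (hsc : SCont χ) (hdy : SolvesDyson FH χ₀ χ) (hT : 0 ≤ Sadj ∘L FH ∘L Smap)
    {L : 𝓗 →L[ℂ] 𝓗} (hL : IsSelfAdjoint L)
    (hQ : P.Represents (fun a => (SpectralData.cutInv E₀ g a : ℂ)) (L * L)) :
    IsFourierTransformOf χ (fun z => (2 : ℂ) • (Smap ∘L (L * Ring.inverse
      (z ^ 2 • (L * L * (L * L)) - (1 + (2 : ℂ) • (L * (Sadj ∘L FH ∘L Smap) * L))) * L) ∘L Sadj))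
      (2 * ‖Sadj ∘L FH ∘L Smap‖) := by
  intro z hz f
  set T := Sadj ∘L FH ∘L Smap with hTdef
  have hz0 : 0 < z.im := (by positivity : (0 : ℝ) ≤ 2 * ‖T‖).trans_lt hz
  set h : ℝ → 𝓗 := fun s => Sadj (FH (χ (Real.toNNReal s) f)) with hh
  have hhc : Continuous h := (Sadj ∘L FH).continuous.comp ((hsc f).comp continuous_real_toNNReal)
  set u : ℝ → 𝓗 := fun t => (2 : ℂ) • sinOp t (Sadj f) +
    (2 : ℂ) • ∫ s in (0 : ℝ)..t, sinOp (t - s) (h s) with hu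
  have hA : ∀ t, ‖sinOp t‖ ≤ 1 := fun t => SpectralData.norm_sinOp_le hsin t
  have hAc : ∀ x, Continuous fun t => sinOp t x := fun x => SpectralData.continuous_sinOp hsin x
  have hχu : ∀ t : ℝ, 0 ≤ t → χ (Real.toNNReal t) f = Smap (u t) := by
    intro t ht
    apply Subtype.coe_injective
    change inclι _ = inclι _
    have hc : Continuous fun s => sinOp (t - s) (h s) :=
      (continuous_volterra_integrand hA hAc hhc).comp
        (by fun_prop : Continuous fun s : ℝ => (t, s))
    rw [(hdy (Real.toNNReal t) f).2, hχ₀, Real.coe_toNNReal t ht]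
    have e1 : ∫ s in (0 : ℝ)..t, inclι (χ₀ (Real.toNNReal t - Real.toNNReal s)
        (FH (χ (Real.toNNReal s) f))) =
        ∫ s in (0 : ℝ)..t, ((2 : ℂ) • (inclι ∘L Smap)) (sinOp (t - s) (h s)) := by
      refine intervalIntegral.integral_congr fun s hs => ?_
      rw [Set.uIcc_of_le ht] at hs
      simp only [hχ₀]
      rw [NNReal.coe_sub (Real.toNNReal_le_toNNReal hs.2), Real.coe_toNNReal _ ht,
        Real.coe_toNNReal _ hs.1]
      rfl
    rw [e1, ContinuousLinearMap.intervalIntegral_comp_comm _ (hc.intervalIntegrable _ _)]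
    simp only [hu, map_add, map_smul]
    rfl
  have hTu : ∀ t, 0 ≤ t → T (u t) = h t := fun t ht => by
    simp only [hTdef, hh, hχu t ht, ContinuousLinearMap.comp_apply]
  have hint := integrableOn_exp_smul_volterra hA hAc hhc (fun t => rfl) hTu hz
  have hLL : 0 ≤ L * L * (L * L) :=
    SpectralData.nonneg_of_isSelfAdjoint_mul_self (by rw [← pow_two]; exact hL.pow 2)
  have hu1 := isUnit_pencil hLL le_rfl (sq_im_ne_zero_or_re_nonpos (.inl hz0.ne'))
  have hu2 := isUnit_pencil hLL (one_le_one_add_conjugate hL hT)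
    (sq_im_ne_zero_or_re_nonpos (.inl hz0.ne'))
  have hlap := laplace_volterra hA (fun t => (hsin t).isSelfAdjoint) hAc hhc (fun t => rfl) hTu hz
    (SpectralData.integral_exp_smul_sinOp hsin hz0
      (SpectralData.represents_resolvent hg hgap hQ hz0 hu1))
  have hU := eq_pencil_inverse_of_eq_resolvent hu1 hu2 hlap
  have hcongr : ∀ t ∈ Set.Ioi (0 : ℝ), (inclι ∘L Smap) (Complex.exp (Complex.I * z * t) • u t) =
      Complex.exp (Complex.I * z * t) • inclι (χ (Real.toNNReal t) f) := fun t ht => by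
    rw [map_smul, hχu t (le_of_lt ht)]
    rfl
  refine ⟨((inclι ∘L Smap).integrable_comp hint).congr ?_, ?_⟩
  · filter_upwards [ae_restrict_mem measurableSet_Ioi] with t ht using hcongr t ht
  · rw [← setIntegral_congr_fun measurableSet_Ioi hcongr,
      ContinuousLinearMap.integral_comp_comm _ hint, hU]
    simp

/-! ### Meromorphic families with simple poles -/

section RemoveSing

variable {V : Type*} [NormedAddCommGroup V]

/-- The function obtained from `f` by filling in its removable singularities. -/
def removeSing (f : ℂ → V) (z : ℂ) : V := (nhdsWithin z {z}ᶜ).limUnder f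

theorem removeSing_eq {f G : ℂ → V} {z : ℂ} (hG : ContinuousAt G z)
    (h : ∀ᶠ w in nhdsWithin z {z}ᶜ, f w = G w) : removeSing f z = G z :=
  ((hG.tendsto.mono_left nhdsWithin_le_nhds).congr' (h.mono fun _ hw => hw.symm)).limUnder_eq

theorem eventually_removeSing_eq {f G : ℂ → V} {z : ℂ}
    (hG : ∀ᶠ w in nhdsWithin z {z}ᶜ, ContinuousAt G w)
    (h : ∀ᶠ w in nhdsWithin z {z}ᶜ, f w = G w) :
    ∀ᶠ w in nhdsWithin z {z}ᶜ, removeSing f w = G w := by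
  filter_upwards [hG, eventually_eventually_nhdsWithin.2 h, self_mem_nhdsWithin] with w hw hfw hwz
  rw [isOpen_compl_singleton.nhdsWithin_eq hwz] at hfw
  exact removeSing_eq hw (hfw.filter_mono nhdsWithin_le_nhds)

theorem analyticAt_removeSing [NormedSpace ℂ V] {f G : ℂ → V} {z : ℂ}
    (hG : ∀ᶠ w in nhds z, AnalyticAt ℂ G w)
    (h : ∀ᶠ w in nhdsWithin z {z}ᶜ, f w = G w) : AnalyticAt ℂ (removeSing f) z := by
  refine hG.self_of_nhds.congr ?_
  have h1 := eventually_removeSing_eq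
    ((hG.mono fun w hw => hw.continuousAt).filter_mono nhdsWithin_le_nhds) h
  filter_upwards [eventually_nhdsWithin_iff.1 h1] with w hw
  by_cases hwz : w = z
  · rw [hwz]; exact (removeSing_eq hG.self_of_nhds.continuousAt h).symm
  · exact (hw hwz).symm

end RemoveSing

section Merom

variable {E F : Type*} [NormedAddCommGroup E] [NormedSpace ℂ E] [NormedAddCommGroup F]
  [NormedSpace ℂ F]

theorem MeromAt.meromorphicAt {K : ℂ → (E →L[ℂ] F)} {z₀ : ℂ} (h : MeromAt K z₀) :
    MeromorphicAt K z₀ := by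
  obtain ⟨k, c, K₀, U, hU, hz, hK₀, -, h⟩ := h
  have h1 : MeromorphicAt
      (fun z => K₀ z + ∑ j ∈ Finset.range k, ((z - z₀) ^ (j + 1))⁻¹ • c j) z₀ := by
    refine (hK₀ z₀ hz).meromorphicAt.add (MeromorphicAt.fun_sum fun j _ => ?_)
    exact MeromorphicAt.smul (f := fun z => ((z - z₀) ^ (j + 1))⁻¹) (by fun_prop) (MeromorphicAt.const _ _)
  refine h1.congr ?_
  filter_upwards [mem_nhdsWithin_of_mem_nhds (hU.mem_nhds hz), self_mem_nhdsWithin] with z hz1 hz2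
  exact (h z hz1 hz2).symm

/-- Meromorphic families that agree near one point of a preconnected set agree throughout. -/
theorem MeromOn.eq_of_eventuallyEq {K K' : ℂ → (E →L[ℂ] F)} {D : Set ℂ} (hK : MeromOn K D)
    (hK' : MeromOn K' D) (hD : IsPreconnected D) {z₁ z : ℂ} (hz₁ : z₁ ∈ D)
    (h : ∀ᶠ w in nhds z₁, K' w = K w) (hz : z ∈ D) (hKz : AnalyticAt ℂ K z)
    (hKz' : AnalyticAt ℂ K' z) : K' z = K z := by
  have hm : MeromorphicOn (K' - K) D := fun w hw =>
    (hK' w hw).meromorphicAt.sub (hK w hw).meromorphicAt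
  have htop : meromorphicOrderAt (K' - K) z = ⊤ := by
    by_contra hne
    refine hm.meromorphicOrderAt_ne_top_of_isPreconnected hD hz hz₁ hne ?_
    rw [meromorphicOrderAt_eq_top_iff]
    filter_upwards [h.filter_mono nhdsWithin_le_nhds] with w hw
    rw [Pi.sub_apply, hw, sub_self]
  rw [meromorphicOrderAt_eq_top_iff] at htop
  have hc : Filter.Tendsto (K' - K) (nhdsWithin z {z}ᶜ) (nhds ((K' - K) z)) :=
    (hKz'.sub hKz).continuousAt.tendsto.mono_left nhdsWithin_le_nhds
  have h0 : Filter.Tendsto (K' - K) (nhdsWithin z {z}ᶜ) (nhds 0) :=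
    tendsto_const_nhds.congr' (htop.mono fun w hw => hw.symm)
  exact sub_eq_zero.1 (tendsto_nhds_unique hc h0)

/-- Near `z₀`, `f` is a holomorphic family plus a finite-rank principal part of order one. -/
def SimpleFormAt (f : ℂ → (E →L[ℂ] F)) (z₀ : ℂ) : Prop :=
  ∃ (G : ℂ → (E →L[ℂ] F)) (c : E →L[ℂ] F),
    (∀ᶠ z in nhds z₀, AnalyticAt ℂ G z) ∧ FiniteRankOp c ∧
    ∀ᶠ z in nhdsWithin z₀ {z₀}ᶜ, f z = G z + (z - z₀)⁻¹ • c

theorem SimpleFormAt.removeSing {f : ℂ → (E →L[ℂ] F)} {z₀ : ℂ} (h : SimpleFormAt f z₀) :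
    MeromAt (removeSing f) z₀ ∧ (¬ AnalyticAt ℂ (removeSing f) z₀ → IsPoleAt (removeSing f) z₀) := by
  obtain ⟨G, c, hG, hc, hf⟩ := h
  have hcont : ∀ᶠ w in nhdsWithin z₀ {z₀}ᶜ, ContinuousAt (fun z => G z + (z - z₀)⁻¹ • c) w := by
    filter_upwards [hG.filter_mono nhdsWithin_le_nhds, self_mem_nhdsWithin]
      with w hw hwz
    have := hw.continuousAt
    have h2 : w - z₀ ≠ 0 := sub_ne_zero.2 hwz
    fun_prop (disch := assumption)
  have hev := eventually_nhdsWithin_iff.1 (eventually_removeSing_eq hcont hf)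
  obtain ⟨U, hUs, hU, hz⟩ := eventually_nhds_iff.1 (hev.and hG)
  have hGU : AnalyticOnNhd ℂ G U := fun w hw => (hUs w hw).2
  refine ⟨⟨1, fun _ => c, G, U, hU, hz, hGU, fun _ => hc, fun w hw hwz => ?_⟩, fun hna => ?_⟩
  · simpa using (hUs w hw).1 hwz
  · refine ⟨c, ?_, hc, G, U, hU, hz, hGU, fun w hw hwz => (hUs w hw).1 hwz⟩
    rintro rfl
    exact hna (analyticAt_removeSing hG (by simpa using hf))

end Merom

section Pencil

variable {E F : Type*} [NormedAddCommGroup E] [NormedSpace ℂ E] [NormedAddCommGroup F]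
  [NormedSpace ℂ F] [CompleteSpace 𝓗] {Q W : 𝓗 →L[ℂ] 𝓗}

theorem eventually_analyticAt_comp_comp {G : ℂ → 𝓗 →L[ℂ] 𝓗} {z : ℂ} (hG : AnalyticAt ℂ G z)
    (A : 𝓗 →L[ℂ] F) (B : E →L[ℂ] 𝓗) : ∀ᶠ w in nhds z, AnalyticAt ℂ (fun w => A ∘L G w ∘L B) w :=
  hG.eventually_analyticAt.mono fun w hw =>
    ((ContinuousLinearMap.compL ℂ E 𝓗 F A) ∘L
      ((ContinuousLinearMap.compL ℂ E 𝓗 𝓗).flip B)).analyticAt (G w) |>.fun_comp hw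

theorem eventually_analyticAt_pencil_inverse {z : ℂ} (h : IsUnit (z ^ 2 • Q - W)) (A : 𝓗 →L[ℂ] F)
    (B : E →L[ℂ] 𝓗) :
    ∀ᶠ w in nhds z, AnalyticAt ℂ (fun w => A ∘L Ring.inverse (w ^ 2 • Q - W) ∘L B) w := by
  refine eventually_analyticAt_comp_comp ?_ A B
  obtain ⟨u, hu⟩ := h
  have h1 := analyticAt_inverse (𝕜 := ℂ) u
  rw [hu] at h1
  exact AnalyticAt.fun_comp (f := fun z : ℂ => z ^ 2 • Q - W) h1 (by fun_prop)

theorem inv_sq_sub_sq {z z₀ : ℂ} (h0 : z₀ ≠ 0) (h1 : z - z₀ ≠ 0) (h2 : z + z₀ ≠ 0) :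
    (z ^ 2 - z₀ ^ 2)⁻¹ = (z - z₀)⁻¹ * (2 * z₀)⁻¹ - (z + z₀)⁻¹ * (2 * z₀)⁻¹ := by
  have h3 : z ^ 2 - z₀ ^ 2 ≠ 0 := by
    rw [sq_sub_sq]; exact mul_ne_zero h2 h1
  field_simp
  ring

theorem simpleFormAt_pencil_inverse {C : 𝓗 →L[ℂ] 𝓗} {G : ℂ → 𝓗 →L[ℂ] 𝓗} {z₀ : ℂ} (h0 : z₀ ≠ 0)
    (hC : FiniteRankOp C) (hG : AnalyticAt ℂ G (z₀ ^ 2))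
    (h : ∀ᶠ ζ in nhdsWithin (z₀ ^ 2) {z₀ ^ 2}ᶜ,
      Ring.inverse (ζ • Q - W) = G ζ + (ζ - z₀ ^ 2)⁻¹ • C) (A : 𝓗 →L[ℂ] F) (B : E →L[ℂ] 𝓗) :
    SimpleFormAt (fun z => A ∘L Ring.inverse (z ^ 2 • Q - W) ∘L B) z₀ := by
  have hsum0 : z₀ + z₀ ≠ 0 := by rw [← two_mul]; exact mul_ne_zero two_ne_zero h0
  have hne : ∀ᶠ z in nhds z₀, z + z₀ ≠ 0 :=
    (by fun_prop : Continuous fun z : ℂ => z + z₀).continuousAt.eventually_ne hsum0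
  have htend : Filter.Tendsto (fun z : ℂ => z ^ 2) (nhdsWithin z₀ {z₀}ᶜ)
      (nhdsWithin (z₀ ^ 2) {z₀ ^ 2}ᶜ) := by
    refine tendsto_nhdsWithin_iff.2 ⟨((by fun_prop : Continuous fun z : ℂ => z ^ 2).tendsto
      z₀).mono_left nhdsWithin_le_nhds, ?_⟩
    filter_upwards [hne.filter_mono nhdsWithin_le_nhds, self_mem_nhdsWithin] with z hz hzz
    rw [Set.mem_compl_singleton_iff, ← sub_ne_zero, sq_sub_sq]
    exact mul_ne_zero hz (sub_ne_zero.2 hzz)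
  refine ⟨fun z => A ∘L (G (z ^ 2) - ((z + z₀)⁻¹ * (2 * z₀)⁻¹) • C) ∘L B,
    A ∘L ((2 * z₀)⁻¹ • C) ∘L B, eventually_analyticAt_comp_comp ?_ A B,
    ((hC.smul _).comp_right B).comp_left A, ?_⟩
  · refine (AnalyticAt.fun_comp (f := fun z : ℂ => z ^ 2) hG (by fun_prop)).sub
      (AnalyticAt.smul (AnalyticAt.mul (AnalyticAt.inv (f := fun z : ℂ => z + z₀) (by fun_prop) hsum0) analyticAt_const)
        analyticAt_const)
  · filter_upwards [htend.eventually h, hne.filter_mono nhdsWithin_le_nhds, self_mem_nhdsWithin]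
      with z hz hz1 hz2
    rw [hz, inv_sq_sub_sq h0 (sub_ne_zero.2 hz2) hz1]
    ext x
    simp only [add_apply, sub_apply, smul_apply, ContinuousLinearMap.comp_apply, map_add, map_sub,
      map_smul, sub_smul, mul_smul]
    abel

end Pencil

theorem isPreconnected_DOmega {Ω : ℝ} (hΩ : 0 < Ω) : IsPreconnected (DOmega Ω) := by
  have h0 : (0 : ℂ) ∈ DOmega Ω := Or.inr (by simpa using hΩ)
  have hs : StarConvex ℝ 0 (DOmega Ω) := by
    refine starConvex_zero_iff.2 fun z hz a ha0 ha1 => ?_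
    rcases ha0.eq_or_lt with rfl | ha0
    · rw [zero_smul]; exact h0
    · rcases hz with hz | hz
      · left
        exact (by simpa [ha0.ne'] using hz)
      · refine Or.inr ?_
        rw [Complex.real_smul, Complex.re_ofReal_mul, abs_mul, abs_of_pos ha0]
        nlinarith [abs_nonneg z.re]
  exact (hs.isPathConnected h0).isConnected.isPreconnected

/-- Theorem 1.2 (i): under Assumption 1 on `H`, with `χ₀` the
density-density response function `χ₀(t) = 2θ(t) S sin(t(E₀−H)) S*` of `H` and `χ^RPA` the
strongly continuous solution of the RPA Dyson equation, the Fourier transform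
`z ↦ ∫₀^∞ χ^RPA(t) e^{izt} dt` (initially defined for large `Im z`) extends uniquely to a
meromorphic family of operators on `D_Ω = ℂ \ ((−∞,−Ω] ∪ [Ω,∞))` whose poles are simple and
contained in `(−Ω, Ω)`. -/
theorem rpa_response_fourier_meromorphic
    {𝓗N : Type*} [NormedAddCommGroup 𝓗N] [InnerProductSpace ℂ 𝓗N] [CompleteSpace 𝓗N]
    (P : SpectralData 𝓗N) (E₀ : ℝ) (Ψ₀ : 𝓗N) (hgs : IsGroundState P E₀ Ψ₀)
    (Ω : ℝ) (hness : P.essSpec.Nonempty) (hΩ : Ω = sInf P.essSpec - E₀) (hΩpos : 0 < Ω)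
    -- the operator `S` of Proposition 2.2, and its adjoint `S*`
    (Smap : 𝓗N →L[ℂ] L1capL2) (Sadj : L2plusLinf →L[ℂ] 𝓗N)
    (hSadj : ∀ (g : Lsp 2 × Lsp ∞) (x : 𝓗N),
      ⟪Sadj (Submodule.Quotient.mk g : L2plusLinf), x⟫_ℂ =
        ∫ y : R3, (starRingEnd ℂ) ((g.1 : R3 → ℂ) y + (g.2 : R3 → ℂ) y) *
          (((Smap x).1.1 : R3 → ℂ) y))
    -- the operators `sin(t(E₀−H))`, via the spectral theorem
    (sinOp : ℝ → (𝓗N →L[ℂ] 𝓗N))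
    (hsin : ∀ (t : ℝ) (x : 𝓗N),
      ⟪x, sinOp t x⟫_ℂ = ∫ lam : ℝ, ((Real.sin (t * (E₀ - lam)) : ℝ) : ℂ) ∂(P.diag x))
    -- the density-density response function `χ₀(t) = 2θ(t) S sin(t(E₀−H)) S*` of `H`
    (χ₀ : ℝ≥0 → (L2plusLinf →L[ℂ] L1capL2))
    (hχ₀ : ∀ t : ℝ≥0, χ₀ t = (2:ℂ) • (Smap ∘L sinOp (t : ℝ) ∘L Sadj))
    -- the RPA response function
    (FH : L1capL2 →L[ℂ] L2plusLinf) (hFH : IsHartree FH)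
    (χRPA : ℝ≥0 → (L2plusLinf →L[ℂ] L1capL2))
    (hsc : SCont χRPA) (hdy : SolvesDyson FH χ₀ χRPA) :
    ∃ (D : ℝ) (K : ℂ → (L2plusLinf →L[ℂ] L1capL2)),
      IsFourierTransformOf χRPA K D ∧
      MeromOn K (DOmega Ω) ∧
      (∀ z₀ ∈ DOmega Ω, ¬ AnalyticAt ℂ K z₀ →
        IsPoleAt K z₀ ∧ z₀.im = 0 ∧ |z₀.re| < Ω) ∧
      (∀ (K' : ℂ → (L2plusLinf →L[ℂ] L1capL2)) (D' : ℝ),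
        IsFourierTransformOf χRPA K' D' → MeromOn K' (DOmega Ω) →
        ∀ z ∈ DOmega Ω, AnalyticAt ℂ K z → AnalyticAt ℂ K' z → K' z = K z) := by
  obtain ⟨g, hg, hgap⟩ := SpectralData.exists_gap hgs
  obtain ⟨L, hL, hQ⟩ := SpectralData.exists_sqrt_cutInv P (E₀ := E₀) hg
  have hT := hartree_nonneg hSadj hFH
  set T := Sadj ∘L FH ∘L Smap with hTdef
  set Q := L * L * (L * L) with hQdef
  set W := 1 + (2 : ℂ) • (L * T * L) with hWdef
  have hQ0 : 0 ≤ Q :=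
    SpectralData.nonneg_of_isSelfAdjoint_mul_self (by rw [← pow_two]; exact hL.pow 2)
  have hW : 1 ≤ W := one_le_one_add_conjugate hL hT
  have hF := isFourierTransformOf_dyson hg hgap hsin hχ₀ hsc hdy hT hL hQ
  set f : ℂ → (L2plusLinf →L[ℂ] L1capL2) := fun z =>
    ((2 : ℂ) • (Smap ∘L L)) ∘L Ring.inverse (z ^ 2 • Q - W) ∘L (L ∘L Sadj) with hf
  have hreg : ∀ z : ℂ, z.im ≠ 0 ∨ z = 0 → ∀ᶠ w in nhds z, AnalyticAt ℂ f w := fun z hz =>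
    eventually_analyticAt_pencil_inverse (isUnit_pencil hQ0 hW (sq_im_ne_zero_or_re_nonpos hz)) _ _
  have hform : ∀ z ∈ DOmega Ω, SimpleFormAt f z := by
    intro z hz
    by_cases hz0 : z.im ≠ 0 ∨ z = 0
    · exact ⟨f, 0, hreg z hz0, finiteRankOp_zero, by simp⟩
    · push Not at hz0
      have hzre : z = (z.re : ℂ) := Complex.ext rfl (by simp [hz0.1])
      have hre : |z.re| < Ω := hz.resolve_left fun h => h hz0.1
      have hre0 : z.re ≠ 0 := fun h => hz0.2 (by rw [hzre, h, Complex.ofReal_zero])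
      have hr0 : 0 < z.re ^ 2 := by positivity
      obtain ⟨R, F, hsum, hFr, hR⟩ := SpectralData.exists_finiteRank_add hg hgs.bottom hΩ hΩpos
        hr0 (sq_lt_sq.2 (hre.trans_le (le_abs_self Ω))) hQ
      obtain ⟨C, G, hC, hG, hev⟩ := pencil_inverse_near hQ0 hW hr0 hsum hFr hR
      have hsq : ((z.re ^ 2 : ℝ) : ℂ) = z ^ 2 := by rw [Complex.ofReal_pow, ← hzre]
      rw [hsq] at hG hev
      exact simpleFormAt_pencil_inverse hz0.2 hC hG (hev.mono fun ζ hζ => hζ.2) _ _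
  have hFou : IsFourierTransformOf χRPA (removeSing f) (2 * ‖T‖) := by
    intro z hz x
    have hz0 : 0 < z.im := (by positivity : (0 : ℝ) ≤ 2 * ‖T‖).trans_lt hz
    have e : removeSing f z = f z := removeSing_eq (G := f)
      (hreg z (.inl hz0.ne')).self_of_nhds.continuousAt (Filter.Eventually.of_forall fun _ => rfl)
    rw [e]
    exact hF z hz x
  have hmer : MeromOn (removeSing f) (DOmega Ω) := fun z hz => (hform z hz).removeSing.1
  refine ⟨2 * ‖T‖, removeSing f, hFou, hmer, fun z hz hna => ⟨(hform z hz).removeSing.2 hna, ?_⟩, ?_⟩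
  · have him : z.im = 0 := by
      by_contra h
      exact hna (analyticAt_removeSing (hreg z (.inl h)) (Filter.Eventually.of_forall fun _ => rfl))
    exact ⟨him, hz.resolve_left fun h => h him⟩
  · intro K' D' hK' hmer' z hz ha ha'
    set m := max (2 * ‖T‖) D' with hm
    set z₁ : ℂ := ((m + 1 : ℝ) : ℂ) * Complex.I with hz₁
    have him : z₁.im = m + 1 := by simp [hz₁]
    have hm0 : 0 ≤ m := (by positivity : (0 : ℝ) ≤ 2 * ‖T‖).trans (le_max_left _ _)
    refine hmer.eq_of_eventuallyEq hmer' (isPreconnected_DOmega hΩpos)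
      (Or.inl (by rw [him]; positivity) : z₁ ∈ DOmega Ω) ?_ hz ha ha'
    have hgt : ∀ᶠ w in nhds z₁, m < w.im :=
      Complex.continuous_im.continuousAt.eventually_const_lt (by rw [him]; linarith)
    filter_upwards [hgt] with w hw
    ext1 x
    apply Subtype.coe_injective
    change inclι _ = inclι _
    rw [(hK' w ((le_max_right _ _).trans_lt hw) x).2, (hFou w ((le_max_left _ _).trans_lt hw) x).2]

end
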